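/- For each nonnegative integer i there is an injective group homomorphism ε_i : Q_{4,2} → G_i satisfying ε_i(p(X)) = x and ε_i(p(Y)) = y. -/

import Mathlib

/-!
Common setup: the commutator convention `[a,b] = a⁻¹b⁻¹ab` of the paper, the sequence
`x₀ = x`, `x_{i+1} = [yxy, x_i]`, the Laurent polynomial ring `R = 𝔽₂[t,t⁻¹]`, and the
images `X`, `Y` of `σ₁σ₂σ₃` and `σ₁σ₂σ₃σ₁` in `GL(3, R)` under the mod-2 reduced Burau
representation of the 4-strand braid group.
-/

open Matrix LaurentPolynomial

noncomputable section

set_option maxRecDepth 100000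

/-- The paper's commutator convention: `[a,b] = a⁻¹b⁻¹ab`. -/
def br {G : Type*} [Group G] (a b : G) : G := a⁻¹ * b⁻¹ * a * b

/-- The recursively defined elements `x₀ = x`, `x_{i+1} = [yxy, x_i]`. -/
def xseq {G : Type*} [Group G] (x y : G) : ℕ → G
  | 0 => x
  | n + 1 => br (y * x * y) (xseq x y n)

/-- `R = 𝔽₂[t,t⁻¹]`, the ring of Laurent polynomials over the field with two elements. -/
abbrev R2 : Type := LaurentPolynomial (ZMod 2)

instance : CharP R2 2 := charP_of_injective_algebraMap (algebraMap (ZMod 2) R2).injective 2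

/-- The matrix `X = t·!![0,0,1; 1,0,1; 0,1,1]`. -/
def Xmat : Matrix (Fin 3) (Fin 3) R2 := (T 1 : R2) • !![0,0,1; 1,0,1; 0,1,1]

/-- The matrix `Y = t·!![0,0,1; t,1,1; 0,1,1]`. -/
def Ymat : Matrix (Fin 3) (Fin 3) R2 := (T 1 : R2) • !![0,0,1; T 1,1,1; 0,1,1]

/-- An explicit inverse for `Xmat`. -/
def Xmatinv : Matrix (Fin 3) (Fin 3) R2 := (T (-1) : R2) • !![1,1,0; 1,0,1; 1,0,0]

/-- An explicit inverse for `Ymat`. -/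
def Ymatinv : Matrix (Fin 3) (Fin 3) R2 := (T (-2) : R2) • !![0,1,1; T 1,0,T 1; T 1,0,0]

lemma Xmat_mul_Xmatinv : Xmat * Xmatinv = 1 := by
  rw [Xmat, Xmatinv, Matrix.smul_mul, Matrix.mul_smul, smul_smul, ← T_add]
  simp only [Matrix.mul_fin_three, mul_zero, zero_mul, mul_one, one_mul, add_zero, zero_add,
    ← T_add, CharTwo.add_self_eq_zero]
  rw [Matrix.one_fin_three]
  simp only [Matrix.smul_of, Matrix.smul_cons, smul_eq_mul, Matrix.smul_empty, ← T_add,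
    mul_zero, mul_one]
  norm_num [T_zero]

lemma Xmatinv_mul_Xmat : Xmatinv * Xmat = 1 := by
  rw [Xmat, Xmatinv, Matrix.smul_mul, Matrix.mul_smul, smul_smul, ← T_add]
  simp only [Matrix.mul_fin_three, mul_zero, zero_mul, mul_one, one_mul, add_zero, zero_add,
    ← T_add, CharTwo.add_self_eq_zero]
  rw [Matrix.one_fin_three]
  simp only [Matrix.smul_of, Matrix.smul_cons, smul_eq_mul, Matrix.smul_empty, ← T_add,
    mul_zero, mul_one]
  norm_num [T_zero]

lemma Ymat_mul_Ymatinv : Ymat * Ymatinv = 1 := by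
  rw [Ymat, Ymatinv, Matrix.smul_mul, Matrix.mul_smul, smul_smul, ← T_add]
  simp only [Matrix.mul_fin_three, mul_zero, zero_mul, mul_one, one_mul, add_zero, zero_add,
    ← T_add, CharTwo.add_self_eq_zero]
  rw [Matrix.one_fin_three]
  simp only [Matrix.smul_of, Matrix.smul_cons, smul_eq_mul, Matrix.smul_empty, ← T_add,
    mul_zero, mul_one]
  norm_num [T_zero]

lemma Ymatinv_mul_Ymat : Ymatinv * Ymat = 1 := by
  rw [Ymat, Ymatinv, Matrix.mul_smul, Matrix.smul_mul, smul_smul, ← T_add]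
  simp only [Matrix.mul_fin_three, mul_zero, zero_mul, mul_one, one_mul, add_zero, zero_add,
    ← T_add, CharTwo.add_self_eq_zero]
  rw [Matrix.one_fin_three]
  simp only [Matrix.smul_of, Matrix.smul_cons, smul_eq_mul, Matrix.smul_empty, ← T_add,
    mul_zero, mul_one]
  norm_num [T_zero]

/-- `X ∈ GL(3, 𝔽₂[t,t⁻¹])`, the mod-2 reduced Burau image of `σ₁σ₂σ₃`. -/
def X : GL (Fin 3) R2 := ⟨Xmat, Xmatinv, Xmat_mul_Xmatinv, Xmatinv_mul_Xmat⟩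

/-- `Y ∈ GL(3, 𝔽₂[t,t⁻¹])`, the mod-2 reduced Burau image of `σ₁σ₂σ₃σ₁`. -/
def Y : GL (Fin 3) R2 := ⟨Ymat, Ymatinv, Ymat_mul_Ymatinv, Ymatinv_mul_Ymat⟩

/-- `PGL(3, R)`, the projective general linear group: `GL(3,R)` modulo its center
(the subgroup of scalars). -/
abbrev PGL3 : Type := GL (Fin 3) R2 ⧸ Subgroup.center (GL (Fin 3) R2)

/-- The natural projection `p : GL(3,R) → PGL(3,R)`. -/
def pp : GL (Fin 3) R2 →* PGL3 := QuotientGroup.mk' (Subgroup.center (GL (Fin 3) R2))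

/-- `Q_{4,2}`, the image of the mod-2 projective Burau representation: the subgroup of
`PGL(3,R)` generated by `p(X)` and `p(Y)`. -/
abbrev Q42 : Subgroup PGL3 := Subgroup.closure {pp X, pp Y}

/-- The generator `x` of the free group on `x, y, t`. -/
def gx : FreeGroup (Fin 3) := FreeGroup.of 0

/-- The generator `y` of the free group on `x, y, t`. -/
def gy : FreeGroup (Fin 3) := FreeGroup.of 1

/-- The generator `t` of the free group on `x, y, t`. -/
def gT : FreeGroup (Fin 3) := FreeGroup.of 2

/-- The relators of
`G_i = ⟨x,y,t | x_j⁴ = y³ = 1 = [x_j², yxy] (0 ≤ j ≤ i), [t,yxy] = 1, t·x_i·t⁻¹ = [yxy,x_i]⟩`. -/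
def GiRels (i : ℕ) : Set (FreeGroup (Fin 3)) :=
  {gy ^ 3, br gT (gy * gx * gy),
      gT * xseq gx gy i * gT⁻¹ * (br (gy * gx * gy) (xseq gx gy i))⁻¹} ∪
    {r | ∃ j ≤ i, r = xseq gx gy j ^ 4} ∪
    {r | ∃ j ≤ i, r = br (xseq gx gy j ^ 2) (gy * gx * gy)}

namespace Bu

section grp
variable {A : Type*} [Group A]

def zs (x z : A) : ℕ → A
  | 0 => x
  | n + 1 => br z (zs x z n)

lemma xseq_eq_zs (x y : A) (n : ℕ) : xseq x y n = zs x (y * x * y) n := by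
  induction n with
  | zero => rfl
  | succ n ih => simp only [xseq, zs, ih]

lemma zs_shift (x z : A) (n k : ℕ) : zs (zs x z k) z n = zs x z (n + k) := by
  induction n with
  | zero => simp [zs]
  | succ n ih => rw [show n + 1 + k = (n + k) + 1 by ring]; simp only [zs, ih]

lemma zs_map {B : Type*} [Group B] (f : A →* B) (x z : A) (n : ℕ) :
    f (zs x z n) = zs (f x) (f z) n := by
  induction n with
  | zero => rfl
  | succ n ih => simp [zs, br, ih]

def HH (x z : A) : Prop := ∀ n, zs x z n ^ 4 = 1 ∧ Commute (zs x z n ^ 2) z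

lemma HH.shift {x z : A} (h : HH x z) (k : ℕ) : HH (zs x z k) z := by
  intro n; rw [zs_shift]; exact h _

/-- something commuting with `x` and `z` commutes with `zs`. -/
lemma comm_zs {x z c : A} (hx : Commute c x) (hz : Commute c z) (n : ℕ) :
    Commute c (zs x z n) := by
  induction n with
  | zero => exact hx
  | succ n ih =>
    simp only [zs, br]
    exact ((hz.inv_right.mul_right ih.inv_right).mul_right hz).mul_right ih

lemma comm_zs_le {x z : A} (h : HH x z) {j n : ℕ} (hjn : j ≤ n) :
    Commute (zs x z j ^ 2) (zs x z n) := by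
  obtain ⟨k, rfl⟩ := Nat.exists_eq_add_of_le hjn
  rw [add_comm j k, ← zs_shift]
  exact comm_zs ((Commute.refl _).pow_left 2) (h j).2 k

def KC (x z : A) (n : ℕ) : Subgroup A := Subgroup.closure {c | ∃ j ≤ n, c = zs x z j ^ 2}

lemma KC_mono {x z : A} {n m : ℕ} (h : n ≤ m) : KC x z n ≤ KC x z m := by
  apply Subgroup.closure_mono
  rintro c ⟨j, hj, rfl⟩
  exact ⟨j, hj.trans h, rfl⟩

lemma KC_shift {x z : A} {n : ℕ} : KC (zs x z 1) z n ≤ KC x z (n + 1) := by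
  apply Subgroup.closure_mono
  rintro c ⟨j, hj, rfl⟩
  exact ⟨j + 1, by omega, by rw [zs_shift]⟩

lemma KC_comm {x z a : A} {n : ℕ} (h : ∀ j ≤ n, Commute (zs x z j ^ 2) a) {k : A}
    (hk : k ∈ KC x z n) : Commute k a := by
  induction hk using Subgroup.closure_induction with
  | mem c hc => obtain ⟨j, hj, rfl⟩ := hc; exact h j hj
  | one => exact Commute.one_left _
  | mul a b _ _ ha hb => exact ha.mul_left hb
  | inv a _ ha => exact ha.inv_left

lemma KC_sq {x z : A} (h : HH x z) {n : ℕ} {k : A}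
    (hk : k ∈ KC x z n) : k * k = 1 := by
  have hcc : ∀ i j, Commute (zs x z i ^ 2) (zs x z j ^ 2) := by
    intro i j
    rcases le_total i j with hij | hij
    · exact (comm_zs_le h hij).pow_right 2
    · exact ((comm_zs_le h hij).pow_right 2).symm
  have hkc : ∀ {k}, k ∈ KC x z n → ∀ j, Commute k (zs x z j ^ 2) := fun hk j =>
    KC_comm (fun i _ => hcc i j) hk
  induction hk using Subgroup.closure_induction with
  | mem c hc => obtain ⟨j, hj, rfl⟩ := hc; rw [← pow_add]; exact (h j).1
  | one => simp
  | mul a b ha hb iha ihb =>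
    have : Commute b a := KC_comm (fun j _ => (hkc ha j).symm) hb
    calc a * b * (a * b) = a * (b * a) * b := by group
      _ = (a * a) * (b * b) := by rw [this.eq]; group
      _ = 1 := by rw [iha, ihb, one_mul]
  | inv a _ ha => rw [← _root_.mul_inv_rev, ha, inv_one]

def PQ (z : A) (n : ℕ) : Prop := ∀ x : A, HH x z →
  Commute (zs x z n ^ 2) x ∧ ∃ κ ∈ KC x z n, x * zs x z n * x⁻¹ = (zs x z n)⁻¹ * κ


lemma x_conj_z {x z : A} (h : HH x z) : x * z * x⁻¹ = z * zs x z 1 := by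
  have h2 : x ^ 2 * z = z * x ^ 2 := (h 0).2.eq
  have : x * z * x⁻¹ = x⁻¹ * (x ^ 2 * z) * x⁻¹ := by group
  rw [this, h2]; simp only [zs, br]; group

lemma x_conj_x1 {x z : A} (h : HH x z) : x * zs x z 1 * x⁻¹ = (zs x z 1)⁻¹ := by
  have h2 : x ^ 2 * z = z * x ^ 2 := (h 0).2.eq
  have h3 : x ^ 2 * z⁻¹ = z⁻¹ * x ^ 2 := ((h 0).2.inv_right).eq
  have : x * zs x z 1 * x⁻¹ = x⁻¹ * (x ^ 2 * z⁻¹) * x⁻¹ * z := by simp only [zs, br]; group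
  rw [this, h3]; simp only [zs, br]; group

lemma pq_all (z : A) (n : ℕ) : PQ z n := by
  induction n using Nat.strong_induction_on with
  | _ n ih =>
    match n, ih with
    | 0, _ =>
      intro x h
      exact ⟨(Commute.refl x).pow_left 2, x ^ 2, Subgroup.subset_closure ⟨0, le_rfl, rfl⟩,
        by simp only [zs]; group⟩
    | n + 1, ih =>
      intro x h
      -- c_j for j ≤ n commute with x
      have hcx : ∀ j ≤ n, Commute (zs x z j ^ 2) x := fun j hj => (ih j (by omega) x h).1
      have hx1 := h.shift 1
      have hcx1 : ∀ j ≤ n, Commute (zs x z (j + 1) ^ 2) (zs x z 1) := fun j hj => by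
        have := (ih j (by omega) _ hx1).1
        rwa [zs_shift] at this
      -- the claim on κ
      have key : ∃ κ ∈ KC x z (n + 1), x * zs x z (n + 1) * x⁻¹ = (zs x z (n + 1))⁻¹ * κ := by
        rcases Nat.eq_zero_or_pos n with rfl | hn
        · exact ⟨1, one_mem _, by rw [mul_one]; exact x_conj_x1 h⟩
        obtain ⟨κ, hκ, e⟩ := (ih n (by omega) x h).2
        obtain ⟨κ'', hκ'', e''⟩ := (ih n (by omega) _ hx1).2
        obtain ⟨κ', hκ', e'⟩ := (ih (n - 1) (by omega) _ hx1).2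
        rw [zs_shift] at e' e''
        have hn1 : n - 1 + 1 = n := by omega
        rw [hn1] at e'
        have hκ'1 : κ' ∈ KC x z n := by
          have := KC_shift hκ'; rwa [hn1] at this
        have hκ''1 : κ'' ∈ KC x z (n + 1) := KC_shift hκ''
        have cen : ∀ {k}, k ∈ KC x z n → Commute k x ∧ Commute k z := fun hk =>
          ⟨KC_comm hcx hk, KC_comm (fun j _ => (h j).2) hk⟩
        have cenz : ∀ {k}, k ∈ KC x z n → ∀ m, Commute k (zs x z m) := fun hk m =>
          comm_zs (cen hk).1 (cen hk).2 m
        have hκ''x1 : Commute κ'' (zs x z 1) := by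
          refine KC_comm (n := n) (fun j hj => ?_) hκ''
          rw [zs_shift]; exact hcx1 j hj
        have hκ''xn : Commute κ'' (zs x z (n + 1)) :=
          KC_comm (fun j hj => comm_zs_le h hj) hκ''1
        have hcn : zs x z n ^ 2 ∈ KC x z n := Subgroup.subset_closure ⟨n, le_rfl, rfl⟩
        refine ⟨κ'' * (κ'⁻¹ * zs x z n ^ 2), mul_mem hκ''1 (KC_mono (by omega)
          (mul_mem (inv_mem hκ'1) hcn)), ?_⟩
        set a := zs x z n with ha
        set b := zs x z (n + 1) with hb
        set x1 := zs x z 1 with hx1'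
        have hb' : b = z⁻¹ * a⁻¹ * z * a := by rw [hb]; simp only [zs, br]; rfl
        have e1 : x * b * x⁻¹ = (x * z * x⁻¹)⁻¹ * (x * a * x⁻¹)⁻¹ * (x * z * x⁻¹) *
            (x * a * x⁻¹) := by rw [hb']; group
        have k1 : κ⁻¹ * (a * (z * x1) * a⁻¹) = (a * (z * x1) * a⁻¹) * κ⁻¹ :=
          (((cenz hκ n).mul_right ((cen hκ).2.mul_right (cenz hκ 1))).mul_right
            (cenz hκ n).inv_right).inv_left.eq
        have e2 : x * b * x⁻¹ = x1⁻¹ * z⁻¹ * a * z * (x1 * a⁻¹) := by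
          rw [e1, e, x_conj_z h, ← hx1']
          calc _ = x1⁻¹ * z⁻¹ * (κ⁻¹ * (a * (z * x1) * a⁻¹)) * κ := by group
            _ = _ := by rw [k1]; group
        have e3 : x1 * a⁻¹ = κ'⁻¹ * a * x1 := by
          have : x1 * a⁻¹ * x1⁻¹ = κ'⁻¹ * a := by
            calc x1 * a⁻¹ * x1⁻¹ = (x1 * a * x1⁻¹)⁻¹ := by group
              _ = _ := by rw [e']; group
          rw [← this]; group
        have c2 : z⁻¹ * a * z * a = a ^ 2 * b := by
          have : a ^ 2 * z⁻¹ = z⁻¹ * a ^ 2 := ((h n).2.inv_right).eq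
          rw [hb']
          calc z⁻¹ * a * z * a = (z⁻¹ * a ^ 2) * a⁻¹ * z * a := by group
            _ = _ := by rw [← this]; group
        have e4 : x1⁻¹ * b * x1 = b⁻¹ * κ'' := by
          have h1 : b = x1⁻¹ * (b⁻¹ * κ'') * x1 := by rw [← e'']; group
          have h2 : b⁻¹ = x1⁻¹ * (κ''⁻¹ * b) * x1 := by
            conv_lhs => rw [h1]
            group
          have h3 : b⁻¹ = κ''⁻¹ * (x1⁻¹ * b * x1) := by
            rw [h2]
            have : κ''⁻¹ * x1⁻¹ = x1⁻¹ * κ''⁻¹ := (hκ''x1.inv_left.inv_right).eq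
            calc _ = (x1⁻¹ * κ''⁻¹) * b * x1 := by group
              _ = _ := by rw [← this]; group
          have h4 : x1⁻¹ * b * x1 = κ'' * b⁻¹ := by rw [h3]; group
          rw [h4]; exact hκ''xn.inv_right.eq
        have k5 : ∀ w : A, κ'⁻¹ * x1⁻¹ = x1⁻¹ * κ'⁻¹ := fun _ =>
          ((cenz hκ'1 1).inv_left.inv_right).eq
        have k6 : κ'⁻¹ * (x1⁻¹ * (z⁻¹ * a * z)) = (x1⁻¹ * (z⁻¹ * a * z)) * κ'⁻¹ :=
          ((cenz hκ'1 1).inv_right.mul_right (((cen hκ'1).2.inv_right.mul_right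
            (cenz hκ'1 n)).mul_right (cen hκ'1).2)).inv_left.eq
        have k7 : a ^ 2 * x1⁻¹ = x1⁻¹ * a ^ 2 := (cenz hcn 1).inv_right.eq
        calc x * b * x⁻¹ = ((x1⁻¹ * (z⁻¹ * a * z)) * κ'⁻¹) * a * x1 := by
              rw [e2, e3]; group
          _ = κ'⁻¹ * x1⁻¹ * (z⁻¹ * a * z * a) * x1 := by rw [← k6]; group
          _ = κ'⁻¹ * (x1⁻¹ * a ^ 2) * b * x1 := by rw [c2]; group
          _ = (κ'⁻¹ * a ^ 2) * (x1⁻¹ * b * x1) := by rw [← k7]; group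
          _ = (κ'⁻¹ * a ^ 2) * (b⁻¹ * κ'') := by rw [e4]
          _ = (b⁻¹ * κ'') * (κ'⁻¹ * a ^ 2) := by
              have hm := mul_mem (inv_mem hκ'1) hcn
              refine ((cenz hm (n+1)).inv_right.mul_right ?_).eq
              refine (KC_comm (x := x) (z := z) (n := n + 1) (fun j hj => ?_) hκ''1).symm
              refine (KC_comm (n := n) (fun i hi => ?_) hm).symm
              exact (comm_zs (hcx i hi) (h i).2 j).pow_right 2
          _ = _ := by group
      refine ⟨?_, key⟩
      obtain ⟨κ, hκ, e⟩ := key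
      have h1 : Commute κ (zs x z (n + 1)) := KC_comm (fun j hj => comm_zs_le h hj) hκ
      have h2 := KC_sq h hκ
      set b := zs x z (n + 1) with hb
      have h3 : x * b ^ 2 * x⁻¹ = b ^ 2 := by
        calc x * b ^ 2 * x⁻¹ = (x * b * x⁻¹) * (x * b * x⁻¹) := by rw [pow_two]; group
          _ = b⁻¹ * (κ * b⁻¹) * κ := by rw [e]; group
          _ = b⁻¹ * b⁻¹ * (κ * κ) := by rw [h1.inv_right.eq]; group
          _ = b⁻¹ * b⁻¹ * b ^ 4 := by rw [h2, (h (n+1)).1]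
          _ = _ := by group
      have h4 : x * b ^ 2 = b ^ 2 * x := by
        calc x * b ^ 2 = x * b ^ 2 * x⁻¹ * x := by group
          _ = _ := by rw [h3]
      exact h4.symm

lemma c_comm_x {x z : A} (h : HH x z) (n : ℕ) : Commute (zs x z n ^ 2) x := (pq_all z n x h).1
lemma c_comm_zs {x z : A} (h : HH x z) (n m : ℕ) : Commute (zs x z n ^ 2) (zs x z m) :=
  comm_zs (c_comm_x h n) (h n).2 m

/-- closure of all squares -/
def CC (x z : A) : Subgroup A := Subgroup.closure {c | ∃ j, c = zs x z j ^ 2}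

lemma KC_le_CC {x z : A} {n : ℕ} : KC x z n ≤ CC x z := by
  apply Subgroup.closure_mono
  rintro c ⟨j, hj, rfl⟩
  exact ⟨j, rfl⟩

lemma CC_comm {x z a : A} (h : ∀ j, Commute (zs x z j ^ 2) a) {k : A}
    (hk : k ∈ CC x z) : Commute k a := by
  induction hk using Subgroup.closure_induction with
  | mem c hc => obtain ⟨j, rfl⟩ := hc; exact h j
  | one => exact Commute.one_left _
  | mul a b _ _ ha hb => exact ha.mul_left hb
  | inv a _ ha => exact ha.inv_left

lemma CC_comm_zs {x z : A} (h : HH x z) {k : A} (hk : k ∈ CC x z) (n : ℕ) :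
    Commute k (zs x z n) := CC_comm (fun j => c_comm_zs h j n) hk

lemma CC_comm_z {x z : A} (h : HH x z) {k : A} (hk : k ∈ CC x z) :
    Commute k z := CC_comm (fun j => (h j).2) hk

lemma CC_shift {x z : A} (m : ℕ) : CC (zs x z m) z ≤ CC x z := by
  apply Subgroup.closure_mono
  rintro c ⟨j, rfl⟩
  exact ⟨j + m, by rw [zs_shift]⟩

lemma c_mem {x z : A} (j : ℕ) : zs x z j ^ 2 ∈ CC x z := Subgroup.subset_closure ⟨j, rfl⟩

lemma zs_conj_le {x z : A} (h : HH x z) {i j : ℕ} (hij : i ≤ j) :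
    ∃ κ ∈ CC x z, zs x z i * zs x z j * (zs x z i)⁻¹ = zs x z j * κ := by
  obtain ⟨k, rfl⟩ := Nat.exists_eq_add_of_le hij
  obtain ⟨κ, hκ, e⟩ := (pq_all z k _ (h.shift i)).2
  rw [zs_shift, add_comm k i] at e
  refine ⟨(zs x z (i + k) ^ 2)⁻¹ * κ, mul_mem (inv_mem (c_mem _))
    (CC_shift i (KC_le_CC hκ)), ?_⟩
  rw [e]; group

lemma zs_conj {x z : A} (h : HH x z) (i j : ℕ) :
    ∃ κ ∈ CC x z, zs x z i * zs x z j * (zs x z i)⁻¹ = κ * zs x z j := by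
  rcases le_total i j with hij | hij
  · obtain ⟨κ, hκ, e⟩ := zs_conj_le h hij
    exact ⟨κ, hκ, by rw [e, (CC_comm_zs h hκ j).eq]⟩
  · obtain ⟨κ, hκ, e⟩ := zs_conj_le h hij
    refine ⟨κ, hκ, ?_⟩
    have := (CC_comm_zs h hκ i).eq
    have h2 := (CC_comm_zs h hκ j).eq
    have e2 : zs x z j * zs x z i = κ * zs x z i * zs x z j := by
      rw [this, ← e]; group
    have e3 : zs x z i * zs x z j = κ⁻¹ * (zs x z j * zs x z i) := by rw [e2]; group
    have hs : κ⁻¹ = κ := by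
      have : κ * κ = 1 := by
        have : ∃ n, κ ∈ KC x z n := by
          clear e this h2 e2 e3
          induction hκ using Subgroup.closure_induction with
          | mem c hc => obtain ⟨m, rfl⟩ := hc; exact ⟨m, Subgroup.subset_closure ⟨m, le_rfl, rfl⟩⟩
          | one => exact ⟨0, one_mem _⟩
          | mul a b _ _ ha hb =>
            obtain ⟨n, hn⟩ := ha
            obtain ⟨m, hm⟩ := hb
            exact ⟨n + m, mul_mem (KC_mono (by omega) hn) (KC_mono (by omega) hm)⟩
          | inv a _ ha => obtain ⟨n, hn⟩ := ha; exact ⟨n, inv_mem hn⟩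
        obtain ⟨n, hn⟩ := this
        exact KC_sq h hn
      exact inv_eq_of_mul_eq_one_left this
    rw [e3, hs]; group

/-- Filtration lemma. -/
def FK (K0 : Subgroup A) (a : ℕ → A) (n : ℕ) : Subgroup A :=
  Subgroup.closure ((K0 : Set A) ∪ {g | ∃ j < n, g = a j})

lemma FK_mono (K0 : Subgroup A) (a : ℕ → A) {n m : ℕ} (h : n ≤ m) : FK K0 a n ≤ FK K0 a m := by
  apply Subgroup.closure_mono
  rintro g (hg | ⟨j, hj, rfl⟩)
  · exact Or.inl hg
  · exact Or.inr ⟨j, by omega, rfl⟩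

lemma FK_K0 {K0 : Subgroup A} {a : ℕ → A} {n : ℕ} : K0 ≤ FK K0 a n :=
  fun _ hg => Subgroup.subset_closure (Or.inl hg)

lemma FK_zero {K0 : Subgroup A} {a : ℕ → A} : FK K0 a 0 = K0 := by
  simp [FK]

structure FOK (K0 : Subgroup A) (a : ℕ → A) : Prop where
  sq : ∀ j, a j * a j ∈ K0
  nor : ∀ j, ∀ k ∈ K0, a j * k * (a j)⁻¹ ∈ K0
  con : ∀ i j, ∃ k ∈ K0, a i * a j * (a i)⁻¹ = k * a j

lemma FK_nor {K0 : Subgroup A} {a : ℕ → A} (h : FOK K0 a) (n j : ℕ) {k : A}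
    (hk : k ∈ FK K0 a n) : a j * k * (a j)⁻¹ ∈ FK K0 a n := by
  induction hk using Subgroup.closure_induction with
  | mem c hc =>
    rcases hc with hc | ⟨i, hi, rfl⟩
    · exact FK_K0 (h.nor j c hc)
    · obtain ⟨k, hk, e⟩ := h.con j i
      rw [e]
      exact mul_mem (FK_K0 hk) (Subgroup.subset_closure (Or.inr ⟨i, hi, rfl⟩))
  | one => simp
  | mul b c _ _ hb hc =>
    have : a j * (b * c) * (a j)⁻¹ = (a j * b * (a j)⁻¹) * (a j * c * (a j)⁻¹) := by group
    rw [this]; exact mul_mem hb hc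
  | inv b _ hb =>
    have : a j * b⁻¹ * (a j)⁻¹ = (a j * b * (a j)⁻¹)⁻¹ := by group
    rw [this]; exact inv_mem hb

lemma FK_succ {K0 : Subgroup A} {a : ℕ → A} (h : FOK K0 a) (n : ℕ) {k : A}
    (hk : k ∈ FK K0 a (n + 1)) : k ∈ FK K0 a n ∨ ∃ k' ∈ FK K0 a n, k = k' * a n := by
  have hsq : a n * a n ∈ FK K0 a n := FK_K0 (h.sq n)
  induction hk using Subgroup.closure_induction with
  | mem c hc =>
    rcases hc with hc | ⟨i, hi, rfl⟩
    · exact Or.inl (FK_K0 hc)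
    · rcases Nat.lt_succ_iff_lt_or_eq.mp hi with hi | rfl
      · exact Or.inl (Subgroup.subset_closure (Or.inr ⟨i, hi, rfl⟩))
      · exact Or.inr ⟨1, one_mem _, by simp⟩
  | one => exact Or.inl (one_mem _)
  | mul b c _ _ hb hc =>
    rcases hb with hb | ⟨b', hb, rfl⟩ <;> rcases hc with hc | ⟨c', hc, rfl⟩
    · exact Or.inl (mul_mem hb hc)
    · exact Or.inr ⟨b * c', mul_mem hb hc, by group⟩
    · exact Or.inr ⟨b' * (a n * c * (a n)⁻¹), mul_mem hb (FK_nor h n n hc), by group⟩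
    · left
      have : b' * a n * (c' * a n) = b' * (a n * c' * (a n)⁻¹) * (a n * a n) := by group
      rw [this]
      exact mul_mem (mul_mem hb (FK_nor h n n hc)) hsq
  | inv b _ hb =>
    rcases hb with hb | ⟨b', hb, rfl⟩
    · exact Or.inl (inv_mem hb)
    · right
      refine ⟨(a n * a n)⁻¹ * (a n * b'⁻¹ * (a n)⁻¹),
        mul_mem (inv_mem hsq) (FK_nor h n n (inv_mem hb)), ?_⟩
      group

lemma filt {K0 : Subgroup A} {a : ℕ → A} (h : FOK K0 a) (ψ : ℕ → A → Prop)
    (h1 : ∀ n, ∀ k ∈ FK K0 a n, ¬ ψ n (k * a n)) (m : ℕ) (n : ℕ) (k : A)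
    (hk : k ∈ FK K0 a n) (hψ : ∀ j, m ≤ j → ψ j k) : k ∈ FK K0 a m := by
  induction n with
  | zero => exact FK_mono _ _ (Nat.zero_le m) hk
  | succ n ih =>
    by_cases hm : n + 1 ≤ m
    · exact FK_mono _ _ hm hk
    rcases FK_succ h n hk with hk | ⟨k', hk', rfl⟩
    · exact ih hk
    · exact absurd (hψ n (by omega)) (h1 n k' hk')

end grp
end Bu

namespace Bu

lemma two0 : (2 : R2) = 0 := CharTwo.two_eq_zero
lemma tq : (T 1 : R2) * T (-1) = 1 := by rw [← T_add]; simp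

/-- `t^k O` -/
def Ok (k : ℤ) : AddSubgroup R2 where
  carrier := {f | ∀ n < k, f.coeff n = 0}
  zero_mem' := fun n _ => by simp
  add_mem' := fun {a b} ha hb n hn => by
    rw [AddMonoidAlgebra.coeff_add]; simp [ha n hn, hb n hn]
  neg_mem' := fun {a} ha n hn => by
    rw [AddMonoidAlgebra.coeff_neg]; simp [ha n hn]

lemma mem_Ok {k : ℤ} {f : R2} : f ∈ Ok k ↔ ∀ n < k, f.coeff n = 0 := Iff.rfl

lemma Ok_anti {k l : ℤ} (h : k ≤ l) {f : R2} (hf : f ∈ Ok l) : f ∈ Ok k :=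
  fun n hn => hf n (by omega)

lemma Ok_mul' {k l : ℤ} {f g : R2} (hf : f ∈ Ok k) (hg : g ∈ Ok l) : f * g ∈ Ok (k + l) := by
  intro n hn
  rw [AddMonoidAlgebra.coeff_mul, Finsupp.sum]
  refine Finset.sum_eq_zero fun a ha => ?_
  rw [Finsupp.sum]
  refine Finset.sum_eq_zero fun b hb => ?_
  rw [if_neg]
  intro hab
  have h1 : k ≤ a := by
    by_contra h; exact (Finsupp.mem_support_iff.mp ha) (hf a (by omega))
  have h2 : l ≤ b := by
    by_contra h; exact (Finsupp.mem_support_iff.mp hb) (hg b (by omega))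
  omega

lemma Ok_mul {k l m : ℤ} {f g : R2} (hf : f ∈ Ok k) (hg : g ∈ Ok l) (h : m ≤ k + l) :
    f * g ∈ Ok m := Ok_anti h (Ok_mul' hf hg)

lemma T_mem {k n : ℤ} : (T n : R2) ∈ Ok k ↔ k ≤ n := by
  constructor
  · intro h
    by_contra hn
    have := h n (by omega)
    simp at this
  · intro h m hm
    rw [T_apply, if_neg (by omega)]

lemma one_mem {k : ℤ} : (1 : R2) ∈ Ok k ↔ k ≤ 0 := by rw [← T_zero, T_mem]

lemma zmod2_cases (a : ZMod 2) : a = 0 ∨ a = 1 := by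
  revert a; decide

lemma Ok_succ {k : ℤ} {f : R2} (hf : f ∈ Ok k) : f ∈ Ok (k + 1) ∨ f + T k ∈ Ok (k + 1) := by
  rcases zmod2_cases (f.coeff k) with h | h
  · left
    intro n hn
    rcases eq_or_ne n k with rfl | hne
    · exact h
    · exact hf n (by omega)
  · right
    intro n hn
    rw [AddMonoidAlgebra.coeff_add, Finsupp.add_apply, T_apply]
    rcases eq_or_ne n k with rfl | hne
    · rw [h, if_pos rfl]; rfl
    · rw [hf n (by omega), if_neg (Ne.symm hne)]; rfl

lemma T_mul_mem {k n : ℤ} {f : R2} : T n * f ∈ Ok k ↔ f ∈ Ok (k - n) := by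
  constructor
  · intro h
    have h2 : T (-n) * (T n * f) = f := by rw [← mul_assoc, ← T_add]; simp
    rw [← h2]
    exact Ok_mul (T_mem.mpr le_rfl) h (by omega)
  · intro h
    exact Ok_mul (T_mem.mpr le_rfl) h (by omega)

def lead (k : ℤ) (f : R2) : Prop := f ∈ Ok k ∧ f ∉ Ok (k + 1)

lemma lead_iff {k : ℤ} {f : R2} : lead k f ↔ f + T k ∈ Ok (k + 1) := by
  constructor
  · rintro ⟨h, h2⟩
    rcases Ok_succ h with h | h
    · exact absurd h h2
    · exact h
  · intro h
    have e : f = (f + T k) + T k := by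
      rw [add_assoc, CharTwo.add_self_eq_zero, add_zero]
    constructor
    · rw [e]; exact add_mem (Ok_anti (by omega) h) (T_mem.mpr le_rfl)
    · intro h2
      have : (T k : R2) ∈ Ok (k + 1) := by
        have := sub_mem h h2
        simpa using this
      have := T_mem.mp this
      omega

lemma lead_T (k : ℤ) : lead k (T k) := ⟨T_mem.mpr le_rfl, by rw [T_mem]; omega⟩

lemma lead_mul {k l : ℤ} {f g : R2} (hf : lead k f) (hg : lead l g) : lead (k + l) (f * g) := by
  rw [lead_iff, T_add]
  have e : f * g + T k * T l = (f + T k) * g + T k * (g + T l) := by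
    linear_combination (-T k * g) * two0
  rw [e]
  exact add_mem (Ok_mul (lead_iff.mp hf) hg.1 (by omega))
    (Ok_mul (T_mem.mpr le_rfl) (lead_iff.mp hg) (by omega))

lemma lead_pow {k : ℤ} {f : R2} (hf : lead k f) (n : ℕ) : lead (n * k) (f ^ n) := by
  induction n with
  | zero => simpa using (T_zero (R := ZMod 2)) ▸ lead_T 0
  | succ n ih =>
    rw [pow_succ, show ((n + 1 : ℕ) : ℤ) * k = n * k + k by push_cast; ring]
    exact lead_mul ih hf

lemma lead_q1 : lead (-1) (1 + T (-1) : R2) := by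
  rw [lead_iff]
  have : (1 + T (-1) + T (-1) : R2) = 1 := by rw [add_assoc, CharTwo.add_self_eq_zero, add_zero]
  rw [this]; exact one_mem.mpr (by omega)

lemma lead_t1 : lead 0 (1 + T 1 : R2) := by
  rw [lead_iff]
  have : (1 + T 1 + T 0 : R2) = T 1 := by
    rw [T_zero]; linear_combination two0
  rw [this]; exact T_mem.mpr (by omega)

lemma lead_ne {k l : ℤ} {f : R2} (h : lead k f) (h2 : lead l f) : k = l := by
  by_contra hne
  rcases lt_or_gt_of_ne hne with h3 | h3
  · exact h.2 (Ok_anti (by omega) h2.1)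
  · exact h2.2 (Ok_anti (by omega) h.1)

lemma O_invert {f : R2} (h : f ∈ Ok 0) (h2 : invert f ∈ Ok 0) : f = 0 ∨ f = 1 := by
  have hc : ∀ n, n ≠ 0 → f.coeff n = 0 := by
    intro n hn
    rcases lt_or_gt_of_ne hn with h3 | h3
    · exact h n h3
    · have := h2 (-n) (by omega)
      simpa using this
  rcases Ok_succ h with h | h
  · left
    apply LaurentPolynomial.ext
    intro n
    rcases eq_or_ne n 0 with rfl | hn
    · rw [h 0 (by omega)]; simp
    · rw [hc n hn]; simp
  · right
    have : f + T 0 = 0 := by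
      apply LaurentPolynomial.ext
      intro n
      rcases eq_or_ne n 0 with rfl | hn
      · rw [h 0 (by omega)]; simp
      · rw [AddMonoidAlgebra.coeff_add, Finsupp.add_apply, hc n hn, T_apply, if_neg (Ne.symm hn)]; simp
    rw [T_zero] at this
    exact CharTwo.add_eq_zero.mp this

abbrev GL3 : Type := GL (Fin 3) R2
abbrev M3 : Type := Matrix (Fin 3) (Fin 3) R2

lemma m3 {S : Type*} {a b c d e f g h i a' b' c' d' e' f' g' h' i' : S} (h1 : a = a') (h2 : b = b')
    (h3 : c = c') (h4 : d = d') (h5 : e = e') (h6 : f = f') (h7 : g = g') (h8 : h = h')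
    (h9 : i = i') : (!![a, b, c; d, e, f; g, h, i] : Matrix (Fin 3) (Fin 3) S) =
      !![a', b', c'; d', e', f'; g', h', i'] := by
  subst h1 h2 h3 h4 h5 h6 h7 h8 h9; rfl

def Umat (a b : R2) : M3 := !![1, a, b; 0, 1, invert a; 0, 0, 1]

lemma Umat_mul (a b a' b' : R2) :
    Umat a b * Umat a' b' = Umat (a + a') (b + b' + a * invert a') := by
  simp only [Umat, Matrix.mul_fin_three, map_add]
  refine m3 ?_ ?_ ?_ ?_ ?_ ?_ ?_ ?_ ?_ <;> ring

lemma Umat_one : Umat 0 0 = 1 := by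
  rw [Matrix.one_fin_three]; simp [Umat]

lemma Umat_inv (a b : R2) : Umat a b * Umat a (b + a * invert a) = 1 := by
  rw [Umat_mul, ← Umat_one, CharTwo.add_self_eq_zero]
  congr 1; linear_combination (b + a * invert a) * two0

lemma Umat_inv' (a b : R2) : Umat a (b + a * invert a) * Umat a b = 1 := by
  rw [Umat_mul, ← Umat_one, CharTwo.add_self_eq_zero]
  congr 1; linear_combination (b + a * invert a) * two0

def UU (a b : R2) : GL3 := ⟨Umat a b, Umat a (b + a * invert a), Umat_inv a b, Umat_inv' a b⟩

lemma UU_val (a b : R2) : (UU a b).val = Umat a b := rfl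

lemma UU_mul (a b a' b' : R2) : UU a b * UU a' b' = UU (a + a') (b + b' + a * invert a') :=
  Units.ext (Umat_mul a b a' b')

lemma UU_inv (a b : R2) : (UU a b)⁻¹ = UU a (b + a * invert a) := Units.ext rfl

lemma UU_zero : UU 0 0 = 1 := Units.ext Umat_one

lemma UU_inj {a b a' b' : R2} (h : UU a b = UU a' b') : a = a' ∧ b = b' := by
  have h := congrArg Units.val h
  have h1 := congrFun (congrFun h 0) 1
  have h2 := congrFun (congrFun h 0) 2
  exact ⟨h1, h2⟩

abbrev t : R2 := T 1
abbrev q : R2 := T (-1)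

def Ym : M3 := !![t, 0, t; 1 + t, 0, t; 1 + t, 1, t]
def Yi : M3 := !![1, 1, 0; 0, 1, 1; 1 + q, 1, 0]

lemma Ym_Yi : Ym * Yi = 1 := by
  simp only [Ym, Yi, Matrix.mul_fin_three, Matrix.one_fin_three]
  have h1 := two0
  have h2 := tq
  refine m3 ?_ ?_ ?_ ?_ ?_ ?_ ?_ ?_ ?_ <;> grind

lemma Yi_Ym : Yi * Ym = 1 := by
  simp only [Ym, Yi, Matrix.mul_fin_three, Matrix.one_fin_three]
  have h1 := two0
  have h2 := tq
  refine m3 ?_ ?_ ?_ ?_ ?_ ?_ ?_ ?_ ?_ <;> grind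

def Yg : GL3 := ⟨Ym, Yi, Ym_Yi, Yi_Ym⟩
def Xg : GL3 := UU 1 1

def Zm : M3 := !![t, 0, 0; 0, 1, t; 0, 0, t]
def Zi : M3 := !![q, 0, 0; 0, 1, 1; 0, 0, q]
lemma Zm_Zi : Zm * Zi = 1 := by
  simp only [Zm, Zi, Matrix.mul_fin_three, Matrix.one_fin_three]
  have h1 := two0
  have h2 := tq
  refine m3 ?_ ?_ ?_ ?_ ?_ ?_ ?_ ?_ ?_ <;> grind
lemma Zi_Zm : Zi * Zm = 1 := by
  simp only [Zm, Zi, Matrix.mul_fin_three, Matrix.one_fin_three]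
  have h1 := two0
  have h2 := tq
  refine m3 ?_ ?_ ?_ ?_ ?_ ?_ ?_ ?_ ?_ <;> grind
def Zg : GL3 := ⟨Zm, Zi, Zm_Zi, Zi_Zm⟩

lemma YXY : Yg * Xg * Yg = Zg := by
  apply Units.ext
  change Ym * Umat 1 1 * Ym = Zm
  simp only [Ym, Zm, Umat, Matrix.mul_fin_three, map_one]
  have h1 := two0
  refine m3 ?_ ?_ ?_ ?_ ?_ ?_ ?_ ?_ ?_ <;> grind

/-- scalar t -/
def tau : GL3 := ⟨Matrix.scalar (Fin 3) t, Matrix.scalar (Fin 3) q, by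
  rw [← map_mul, tq, map_one], by rw [← map_mul, mul_comm, tq, map_one]⟩

lemma tau_val : tau.val = !![t, 0, 0; 0, t, 0; 0, 0, t] := by
  ext i j; fin_cases i <;> fin_cases j <;> simp [tau]

lemma Y3 : Yg * Yg * Yg = tau := by
  apply Units.ext
  rw [tau_val]
  change Ym * Ym * Ym = _
  simp only [Ym, Matrix.mul_fin_three]
  have h1 := two0
  refine m3 ?_ ?_ ?_ ?_ ?_ ?_ ?_ ?_ ?_ <;> grind

lemma invert_q : invert q = t := by simp [q, t]
lemma invert_t : invert t = q := by simp [q, t]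

lemma Z_conj (a b : R2) : Zg⁻¹ * UU a b * Zg = UU (q * a) (b + a) := by
  apply Units.ext
  change Zi * Umat a b * Zm = Umat _ _
  simp only [Zm, Zi, Umat, Matrix.mul_fin_three, map_mul, invert_q]
  have h1 := two0
  have h2 := tq
  refine m3 ?_ ?_ ?_ ?_ ?_ ?_ ?_ ?_ ?_ <;> grind

lemma Z_conj' (a b : R2) : Zg * UU a b * Zg⁻¹ = UU (t * a) (b + t * a) := by
  have : UU a b = Zg⁻¹ * UU (t * a) (b + t * a) * Zg := by
    rw [Z_conj]
    congr 1
    · linear_combination (- a) * tq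
    · linear_combination (- t * a) * two0
  rw [this]; group

def bb : ℕ → R2
  | 0 => 1
  | n + 1 => (1 + q) ^ n + (1 + q) * (1 + q) ^ n * (1 + t) ^ n

lemma X_n (n : ℕ) : zs Xg Zg n = UU ((1 + q) ^ n) (bb n) := by
  induction n with
  | zero => simp [zs, Xg, bb]
  | succ n ih =>
    have : zs Xg Zg (n + 1) = (Zg⁻¹ * zs Xg Zg n * Zg)⁻¹ * zs Xg Zg n := by
      simp only [zs, br]; group
    rw [this, ih, Z_conj, UU_inv, UU_mul]
    simp only [map_mul, map_pow, map_add, map_one, invert_q, bb]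
    have h1 := two0
    have h2 := tq
    congr 1
    · ring
    · generalize (1 + q) ^ n = u
      generalize (1 + t) ^ n = v
      grind

lemma X_n_sq (n : ℕ) : zs Xg Zg n ^ 2 = UU 0 ((1 + q) ^ n * (1 + t) ^ n) := by
  rw [X_n, pow_two, UU_mul]
  simp only [map_pow, map_add, map_one, invert_q, CharTwo.add_self_eq_zero, zero_add]

lemma HH_XZ : HH Xg Zg := by
  intro n
  constructor
  · rw [show 4 = 2 * 2 from rfl, pow_mul, X_n_sq, pow_two, UU_mul]
    simp only [map_zero, CharTwo.add_self_eq_zero, mul_zero, zero_add]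
    exact UU_zero
  · rw [X_n_sq]
    have := Z_conj 0 ((1 + q) ^ n * (1 + t) ^ n)
    rw [mul_zero, add_zero] at this
    change _ = _
    conv_rhs => rw [← this]
    group

end Bu

namespace Bu

structure Dat (G : Type*) [Group G] where
  x : G
  y : G
  hy : y ^ 3 = 1
  hH : HH x (y * x * y)

section dat
variable {G : Type*} [Group G] (D : Dat G)

abbrev Dat.xw : G × GL3 := (D.x, Xg)
abbrev Dat.yw : G × GL3 := (D.y, Yg)
def Dat.zw : G × GL3 := (D.y * D.x * D.y, Zg)
def tw : G × GL3 := (1, tau)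

lemma Dat.zw_eq : D.zw = D.yw * D.xw * D.yw := by
  simp only [Dat.zw, Dat.yw, Dat.xw, Prod.mk_mul_mk, YXY]

lemma tau_comm (g : GL3) : Commute tau g := by
  apply Units.ext
  exact Matrix.scalar_commute t (fun r => mul_comm _ _) g.val

lemma tw_comm (g : G × GL3) : Commute (tw : G × GL3) g :=
  Prod.ext (by simp [tw]) (tau_comm g.2)

lemma Dat.y3 : D.yw * D.yw * D.yw = tw := by
  have := D.hy
  rw [pow_succ, pow_two] at this
  simp only [Dat.yw, Prod.mk_mul_mk, Y3, this, tw]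

lemma Dat.xs_snd (n : ℕ) : (zs D.xw D.zw n).2 = zs Xg Zg n :=
  zs_map (MonoidHom.snd G GL3) D.xw D.zw n

lemma Dat.xs_fst (n : ℕ) : (zs D.xw D.zw n).1 = zs D.x (D.y * D.x * D.y) n :=
  zs_map (MonoidHom.fst G GL3) D.xw D.zw n

lemma Dat.HHw : HH D.xw D.zw := by
  intro n
  have h1 := D.hH n
  have h2 := HH_XZ n
  rw [← D.xs_fst] at h1
  rw [← D.xs_snd] at h2
  exact ⟨Prod.ext h1.1 h2.1, Prod.ext h1.2.eq h2.2.eq⟩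

lemma Dat.x4 : D.xw ^ 4 = 1 := (D.HHw 0).1

def Dat.GP : Subgroup (G × GL3) := Subgroup.closure {D.xw, D.zw, tw}

lemma Dat.x_mem : D.xw ∈ D.GP := Subgroup.subset_closure (by simp)
lemma Dat.z_mem : D.zw ∈ D.GP := Subgroup.subset_closure (by simp)
lemma Dat.t_mem : tw ∈ D.GP := Subgroup.subset_closure (by simp)

abbrev Dat.xs (n : ℕ) : G × GL3 := zs D.xw D.zw n
abbrev Dat.C : Subgroup (G × GL3) := CC D.xw D.zw

def Dat.Hh : Subgroup (G × GL3) := Subgroup.closure ((D.C : Set (G × GL3)) ∪ {g | ∃ j, g = D.xs j})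

lemma Dat.Hh_FK {h : G × GL3} (hh : h ∈ D.Hh) : ∃ n, h ∈ FK D.C D.xs n := by
  induction hh using Subgroup.closure_induction with
  | mem c hc =>
    rcases hc with hc | ⟨j, rfl⟩
    · exact ⟨0, FK_K0 hc⟩
    · exact ⟨j + 1, Subgroup.subset_closure (Or.inr ⟨j, by omega, rfl⟩)⟩
  | one => exact ⟨0, Subgroup.one_mem _⟩
  | mul a b _ _ ha hb =>
    obtain ⟨n, hn⟩ := ha
    obtain ⟨m, hm⟩ := hb
    exact ⟨n + m, mul_mem (FK_mono _ _ (by omega) hn) (FK_mono _ _ (by omega) hm)⟩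
  | inv a _ ha => obtain ⟨n, hn⟩ := ha; exact ⟨n, inv_mem hn⟩

lemma Dat.C_FK {h : G × GL3} (hh : h ∈ D.C) : ∃ n, h ∈ FK ⊥ (fun j => D.xs j ^ 2) n := by
  induction hh using Subgroup.closure_induction with
  | mem c hc =>
    rcases hc with ⟨j, rfl⟩
    exact ⟨j + 1, Subgroup.subset_closure (Or.inr ⟨j, by omega, rfl⟩)⟩
  | one => exact ⟨0, Subgroup.one_mem _⟩
  | mul a b _ _ ha hb =>
    obtain ⟨n, hn⟩ := ha
    obtain ⟨m, hm⟩ := hb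
    exact ⟨n + m, mul_mem (FK_mono _ _ (by omega) hn) (FK_mono _ _ (by omega) hm)⟩
  | inv a _ ha => obtain ⟨n, hn⟩ := ha; exact ⟨n, inv_mem hn⟩

lemma Dat.FOK1 : FOK D.C D.xs where
  sq j := by rw [← pow_two]; exact c_mem j
  nor j k hk := by rw [← (CC_comm_zs D.HHw hk j).eq]; simpa using hk
  con i j := zs_conj D.HHw i j

lemma Dat.FOK2 : FOK (⊥ : Subgroup (G × GL3)) (fun j => D.xs j ^ 2) where
  sq j := by rw [← pow_add]; exact (D.HHw j).1
  nor j k hk := by rw [Subgroup.mem_bot] at *; rw [hk]; group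
  con i j := ⟨1, Subgroup.one_mem _, by
    have := ((c_comm_zs D.HHw i j).pow_right 2).eq
    change D.xs i ^ 2 * D.xs j ^ 2 * _ = _
    rw [this]; group⟩

/-- subgroup of elements with unipotent matrix with entry `a ∈ P`, `b ∈ Q`. -/
def Usub (P : AddSubgroup R2) : Subgroup (G × GL3) where
  carrier := {g | ∃ a ∈ P, ∃ b, g.2 = UU a b}
  one_mem' := ⟨0, zero_mem _, 0, UU_zero.symm⟩
  mul_mem' := by
    rintro g h ⟨a, ha, b, e⟩ ⟨a', ha', b', e'⟩
    exact ⟨_, add_mem ha ha', _, by rw [Prod.snd_mul, e, e', UU_mul]⟩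
  inv_mem' := by
    rintro g ⟨a, ha, b, e⟩
    exact ⟨a, ha, _, by rw [Prod.snd_inv, e, UU_inv]⟩

def Vsub (P : AddSubgroup R2) : Subgroup (G × GL3) where
  carrier := {g | ∃ b ∈ P, g.2 = UU 0 b}
  one_mem' := ⟨0, zero_mem _, UU_zero.symm⟩
  mul_mem' := by
    rintro g h ⟨b, hb, e⟩ ⟨b', hb', e'⟩
    exact ⟨_, add_mem hb hb', by rw [Prod.snd_mul, e, e', UU_mul]; simp⟩
  inv_mem' := by
    rintro g ⟨b, hb, e⟩
    exact ⟨b, hb, by rw [Prod.snd_inv, e, UU_inv]; simp⟩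

lemma leadq (n : ℕ) : lead (-n) ((1 + q) ^ n) := by
  have := lead_pow lead_q1 n
  rwa [mul_neg_one] at this

lemma leadqt (n : ℕ) : lead (-n) ((1 + q) ^ n * (1 + t) ^ n) := by
  have := lead_mul (lead_pow lead_q1 n) (lead_pow lead_t1 n)
  rwa [mul_neg_one, mul_zero, add_zero] at this

lemma Dat.C_V {h : G × GL3} (hh : h ∈ D.C) : ∃ b, h.2 = UU 0 b := by
  have : D.C ≤ Vsub ⊤ := by
    apply (Subgroup.closure_le _).mpr
    rintro c ⟨j, rfl⟩
    exact ⟨_, AddSubgroup.mem_top _, by rw [Prod.pow_snd, D.xs_snd, X_n_sq]⟩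
  obtain ⟨b, _, e⟩ := this hh
  exact ⟨b, e⟩

lemma Dat.FK1 {n : ℕ} : FK D.C D.xs n ≤ Usub (Ok (-n + 1)) := by
  apply (Subgroup.closure_le _).mpr
  rintro c (hc | ⟨j, hj, rfl⟩)
  · obtain ⟨b, e⟩ := D.C_V hc
    exact ⟨0, zero_mem _, b, e⟩
  · exact ⟨(1 + q) ^ j, Ok_anti (by omega) (leadq j).1, _, by rw [D.xs_snd, X_n]⟩

lemma Dat.FK2 {n : ℕ} : FK ⊥ (fun j => D.xs j ^ 2) n ≤ Vsub (Ok (-n + 1)) := by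
  apply (Subgroup.closure_le _).mpr
  rintro c (hc | ⟨j, hj, rfl⟩)
  · have hc : c ∈ (⊥ : Subgroup (G × GL3)) := hc
    rw [Subgroup.mem_bot] at hc
    rw [hc]; exact Subgroup.one_mem _
  · exact ⟨_, Ok_anti (by omega) (leadqt j).1, by rw [Prod.pow_snd, D.xs_snd, X_n_sq]⟩

lemma Dat.H_C {h : G × GL3} (hh : h ∈ D.Hh) {b : R2} (e : h.2 = UU 0 b) : h ∈ D.C := by
  obtain ⟨n, hn⟩ := D.Hh_FK hh
  rw [← FK_zero (K0 := D.C) (a := D.xs)]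
  refine filt D.FOK1 (fun n k => ∀ a b, k.2 = UU a b → a ∈ Ok (-n + 1)) ?_ 0 n h hn ?_
  · intro n k hk hψ
    obtain ⟨a, ha, b, e⟩ := D.FK1 hk
    have h2 : (k * D.xs n).2 = UU (a + (1 + q) ^ n) (b + bb n + a * invert ((1 + q) ^ n)) := by
      rw [Prod.snd_mul, e, D.xs_snd, X_n, UU_mul]
    have h3 := hψ _ _ h2
    apply (leadq n).2
    have := sub_mem h3 ha
    simpa using this
  · intro j _ a b' e'
    rw [e] at e'
    rw [← (UU_inj e').1]
    exact zero_mem _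

lemma Dat.C_x {h : G × GL3} (hh : h ∈ D.C) {b : R2} (hb : b ∈ Ok 0) (e : h.2 = UU 0 b) :
    h = 1 ∨ h = D.xw ^ 2 := by
  obtain ⟨n, hn⟩ := D.C_FK hh
  have : h ∈ FK ⊥ (fun j => D.xs j ^ 2) 1 := by
    refine filt D.FOK2 (fun n k => ∀ b, k.2 = UU 0 b → b ∈ Ok (-n + 1)) ?_ 1 n h hn ?_
    · intro n k hk hψ
      obtain ⟨b, hb, e⟩ := D.FK2 hk
      have h2 : (k * D.xs n ^ 2).2 = UU 0 (b + (1 + q) ^ n * (1 + t) ^ n) := by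
        rw [Prod.snd_mul, e, Prod.pow_snd, D.xs_snd, X_n_sq, UU_mul]; simp
      have h3 := hψ _ h2
      apply (leadqt n).2
      have := sub_mem h3 hb
      simpa using this
    · intro j hj b' e'
      rw [e] at e'
      rw [← (UU_inj e').2]
      exact Ok_anti (by omega) hb
  rcases FK_succ D.FOK2 0 this with h0 | ⟨k, h0, rfl⟩
  · rw [FK_zero, Subgroup.mem_bot] at h0
    exact Or.inl h0
  · rw [FK_zero, Subgroup.mem_bot] at h0
    right; rw [h0, one_mul]; rfl

lemma Dat.Hh_z {h : G × GL3} (hh : h ∈ D.Hh) : D.zw⁻¹ * h * D.zw ∈ D.Hh := by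
  induction hh using Subgroup.closure_induction with
  | mem c hc =>
    rcases hc with hc | ⟨j, rfl⟩
    · rw [mul_assoc, (CC_comm_z D.HHw hc).eq]
      simp only [inv_mul_cancel_left]
      exact Subgroup.subset_closure (Or.inl hc)
    · have : D.zw⁻¹ * D.xs j * D.zw = D.xs j * (D.xs (j + 1))⁻¹ := by
        simp only [Dat.xs, zs, br]; group
      rw [this]
      exact mul_mem (Subgroup.subset_closure (Or.inr ⟨_, rfl⟩))
        (inv_mem (Subgroup.subset_closure (Or.inr ⟨_, rfl⟩)))
  | one => simp
  | mul a b _ _ ha hb =>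
    have : D.zw⁻¹ * (a * b) * D.zw = (D.zw⁻¹ * a * D.zw) * (D.zw⁻¹ * b * D.zw) := by group
    rw [this]; exact mul_mem ha hb
  | inv a _ ha =>
    have : D.zw⁻¹ * a⁻¹ * D.zw = (D.zw⁻¹ * a * D.zw)⁻¹ := by group
    rw [this]; exact inv_mem ha

lemma Dat.Hh_zpow {h : G × GL3} (hh : h ∈ D.Hh) (j : ℤ) (hj : 0 ≤ j) :
    D.zw ^ (-j) * h * D.zw ^ j ∈ D.Hh := by
  obtain ⟨n, rfl⟩ := Int.eq_ofNat_of_zero_le hj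
  clear hj
  induction n with
  | zero => simpa using hh
  | succ n ih =>
    have := D.Hh_z ih
    have e : D.zw⁻¹ * (D.zw ^ (-(n : ℤ)) * h * D.zw ^ (n : ℤ)) * D.zw
        = D.zw ^ (-((n + 1 : ℕ) : ℤ)) * h * D.zw ^ ((n + 1 : ℕ) : ℤ) := by
      push_cast; group
    rwa [e] at this

def Dat.U' : Subgroup (G × GL3) where
  carrier := {u | ∃ m : ℤ, ∀ j ≥ m, D.zw ^ (-j) * u * D.zw ^ j ∈ D.Hh}
  one_mem' := ⟨0, fun j _ => by
    have : D.zw ^ (-j) * 1 * D.zw ^ j = 1 := by group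
    rw [this]; exact Subgroup.one_mem _⟩
  mul_mem' := by
    rintro a b ⟨m, hm⟩ ⟨n, hn⟩
    refine ⟨max m n, fun j hj => ?_⟩
    have e : D.zw ^ (-j) * (a * b) * D.zw ^ j
      = (D.zw ^ (-j) * a * D.zw ^ j) * (D.zw ^ (-j) * b * D.zw ^ j) := by group
    rw [e]
    exact mul_mem (hm j (le_trans (le_max_left _ _) hj)) (hn j (le_trans (le_max_right _ _) hj))
  inv_mem' := by
    rintro a ⟨m, hm⟩
    refine ⟨m, fun j hj => ?_⟩
    have e : D.zw ^ (-j) * a⁻¹ * D.zw ^ j = (D.zw ^ (-j) * a * D.zw ^ j)⁻¹ := by group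
    rw [e]; exact inv_mem (hm j hj)

lemma Dat.U'_z {u : G × GL3} (hu : u ∈ D.U') (k : ℤ) : D.zw ^ (-k) * u * D.zw ^ k ∈ D.U' := by
  obtain ⟨m, hm⟩ := hu
  refine ⟨m - k, fun j hj => ?_⟩
  have e : D.zw ^ (-j) * (D.zw ^ (-k) * u * D.zw ^ k) * D.zw ^ j =
      D.zw ^ (-(j + k)) * u * D.zw ^ (j + k) := by group
  rw [e]; exact hm _ (by omega)

lemma Dat.x_U' : D.xw ∈ D.U' :=
  ⟨0, fun j hj => D.Hh_zpow (Subgroup.subset_closure (Or.inr ⟨0, rfl⟩)) j hj⟩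

lemma Dat.GP_form {g : G × GL3} (hg : g ∈ D.GP) :
    ∃ (n k : ℤ), ∃ u ∈ D.U', g = tw ^ n * D.zw ^ k * u := by
  induction hg using Subgroup.closure_induction with
  | mem c hc =>
    rcases hc with rfl | rfl | rfl
    · exact ⟨0, 0, _, D.x_U', by simp⟩
    · exact ⟨0, 1, 1, Subgroup.one_mem _, by simp⟩
    · exact ⟨1, 0, 1, Subgroup.one_mem _, by simp⟩
  | one => exact ⟨0, 0, 1, Subgroup.one_mem _, by simp⟩
  | mul a b _ _ ha hb =>
    obtain ⟨n, k, u, hu, rfl⟩ := ha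
    obtain ⟨n', k', u', hu', rfl⟩ := hb
    refine ⟨n + n', k + k', _, mul_mem (D.U'_z hu k') hu', ?_⟩
    have := ((tw_comm (D.zw ^ k * u)).zpow_left n').eq
    calc tw ^ n * D.zw ^ k * u * (tw ^ n' * D.zw ^ k' * u')
        = tw ^ n * (D.zw ^ k * u * tw ^ n') * D.zw ^ k' * u' := by group
      _ = _ := by rw [← this]; group
  | inv a _ ha =>
    obtain ⟨n, k, u, hu, rfl⟩ := ha
    refine ⟨-n, -k, _, D.U'_z (inv_mem hu) (-k), ?_⟩
    have := ((tw_comm (u⁻¹ * D.zw ^ (-k))).zpow_left (-n)).eq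
    calc (tw ^ n * D.zw ^ k * u)⁻¹ = (u⁻¹ * D.zw ^ (-k)) * tw ^ (-n) := by group
      _ = _ := by rw [← this]; group

lemma scalar3 (c : R2) : Matrix.scalar (Fin 3) c = !![c, 0, 0; 0, c, 0; 0, 0, c] := by
  ext i j; fin_cases i <;> fin_cases j <;> simp

lemma tau_pow (n : ℤ) : (tau ^ n).val = Matrix.scalar (Fin 3) (T n : R2) := by
  induction n using Int.induction_on with
  | zero => simp
  | succ i ih => rw [_root_.zpow_add_one, Units.val_mul, ih, T_add, map_mul]; rfl
  | pred i ih => rw [_root_.zpow_sub_one, Units.val_mul, ih, T_sub, map_mul]; rfl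

lemma Z_pow (n : ℤ) : ∃ c, (Zg ^ n).val = !![T n, 0, 0; 0, 1, c; 0, 0, T n] := by
  induction n using Int.induction_on with
  | zero => exact ⟨0, by simp [Matrix.one_fin_three]⟩
  | succ i ih =>
    obtain ⟨c, hc⟩ := ih
    refine ⟨t + c * t, ?_⟩
    rw [_root_.zpow_add_one, Units.val_mul, hc, T_add]
    change _ * Zm = _
    simp only [Zm, Matrix.mul_fin_three]
    refine m3 ?_ ?_ ?_ ?_ ?_ ?_ ?_ ?_ ?_ <;> ring
  | pred i ih =>
    obtain ⟨c, hc⟩ := ih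
    refine ⟨1 + c * q, ?_⟩
    rw [_root_.zpow_sub_one, Units.val_mul, hc, T_sub]
    change _ * Zi = _
    simp only [Zi, Matrix.mul_fin_three]
    refine m3 ?_ ?_ ?_ ?_ ?_ ?_ ?_ ?_ ?_ <;> ring

lemma Dat.U'_U {u : G × GL3} (hu : u ∈ D.U') : ∃ a b, u.2 = UU a b := by
  obtain ⟨m, hm⟩ := hu
  have h := hm m le_rfl
  obtain ⟨n, hn⟩ := D.Hh_FK h
  obtain ⟨a, _, b, e⟩ := D.FK1 hn
  have e2 : u = D.zw ^ m * (D.zw ^ (-m) * u * D.zw ^ m) * D.zw ^ (-m) := by group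
  have e3 : u.2 = Zg ^ m * UU a b * Zg ^ (-m) := by
    rw [e2, Prod.snd_mul, Prod.snd_mul, e]; rfl
  rw [e3]
  clear * -
  induction m using Int.induction_on with
  | zero => exact ⟨a, b, by simp⟩
  | succ i ih =>
    obtain ⟨a', b', h⟩ := ih
    refine ⟨_, _, (Eq.trans ?_ (Z_conj' a' b'))⟩
    rw [← h]; group
  | pred i ih =>
    obtain ⟨a', b', h⟩ := ih
    refine ⟨_, _, (Eq.trans ?_ (Z_conj a' b'))⟩
    rw [← h]; group

lemma Dat.GP_mat {g : G × GL3} (hg : g ∈ D.GP) :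
    ∃ (n k : ℤ), ∃ u ∈ D.U', g = tw ^ n * D.zw ^ k * u ∧ ∃ a b c, u.2 = UU a b ∧
      g.2.val = !![T n * T k, T n * T k * a, T n * T k * b; 0, T n, c; 0, 0, T n * T k] := by
  obtain ⟨n, k, u, hu, rfl⟩ := D.GP_form hg
  obtain ⟨a, b, e⟩ := D.U'_U hu
  obtain ⟨c, hc⟩ := Z_pow k
  refine ⟨n, k, u, hu, rfl, a, b, T n * (invert a + c), e, ?_⟩
  have : (tw ^ n * D.zw ^ k * u).2 = tau ^ n * Zg ^ k * UU a b := by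
    rw [← e]; rfl
  rw [this, Units.val_mul, Units.val_mul, tau_pow, hc, UU_val, scalar3]
  simp only [Umat, Matrix.mul_fin_three]
  refine m3 ?_ ?_ ?_ ?_ ?_ ?_ ?_ ?_ ?_ <;> ring

lemma T_inj {a : ℤ} (h : (T a : R2) = 1) : a = 0 := by
  rw [← T_zero] at h
  exact lead_ne (lead_T a) (h ▸ lead_T 0)

def Int3 (g : GL3) : Prop := ∀ i j, g.val i j ∈ Ok 0

lemma Z_comm0 (b : R2) : Commute (UU 0 b) Zg := by
  have := Z_conj 0 b
  rw [mul_zero, add_zero] at this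
  change _ = _
  conv_rhs => rw [← this]
  group

lemma Dat.N'_aux {u : G × GL3} (hu : u ∈ D.U') {b : R2} (hb : b ∈ Ok 0) (e : u.2 = UU 0 b) :
    u = 1 ∨ u = D.xw ^ 2 := by
  obtain ⟨m, hm⟩ := hu
  have h := hm m le_rfl
  have e2 : (D.zw ^ (-m) * u * D.zw ^ m).2 = UU 0 b := by
    have h1 : (D.zw ^ (-m) * u * D.zw ^ m).2 = Zg ^ (-m) * UU 0 b * Zg ^ m := by rw [← e]; rfl
    rw [h1, mul_assoc, ((Z_comm0 b).zpow_right m).eq]; group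
  have h3 := D.H_C h e2
  have h4 := (((CC_comm_z D.HHw h3).zpow_right m)).eq
  have h5 : u = D.zw ^ (-m) * u * D.zw ^ m := by
    calc u = D.zw ^ m * (D.zw ^ (-m) * u * D.zw ^ m) * D.zw ^ (-m) := by group
      _ = _ := by rw [← h4]; group
  rw [← h5] at h3
  exact D.C_x h3 hb e

lemma Dat.N' {g : G × GL3} (hg : g ∈ D.GP) (h1 : Int3 g.2) (h2 : Int3 g⁻¹.2) :
    ∃ k : ℕ, g = D.xw ^ k := by
  obtain ⟨n, k, u, hu, e, a, b, c, eu, em⟩ := D.GP_mat hg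
  obtain ⟨n', k', u', hu', e', a', b', c', eu', em'⟩ := D.GP_mat (inv_mem hg)
  have hn0 : 0 ≤ n := by
    have := h1 1 1; rw [em] at this; exact T_mem.mp this
  have hnk : 0 ≤ n + k := by
    have := h1 2 2; rw [em] at this
    change T n * T k ∈ _ at this
    rw [← T_add] at this; exact T_mem.mp this
  have hn'0 : 0 ≤ n' := by
    have := h2 1 1; rw [em'] at this; exact T_mem.mp this
  have hnk' : 0 ≤ n' + k' := by
    have := h2 2 2; rw [em'] at this
    change T n' * T k' ∈ _ at this
    rw [← T_add] at this; exact T_mem.mp this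
  have hm : g.2.val * g⁻¹.2.val = 1 := by
    rw [← Units.val_mul, ← Prod.snd_mul, mul_inv_cancel]; rfl
  rw [em, em', Matrix.mul_fin_three] at hm
  have e1 : n + n' = 0 := by
    have := congrFun (congrFun hm 1) 1
    change 0 * _ + T n * T n' + c * 0 = 1 at this
    rw [zero_mul, mul_zero, zero_add, add_zero, ← T_add] at this
    exact T_inj this
  have e2 : n + k + (n' + k') = 0 := by
    have := congrFun (congrFun hm 2) 2
    change 0 * _ + 0 * _ + (T n * T k) * (T n' * T k') = 1 at this
    rw [zero_mul, zero_mul, zero_add, zero_add, ← T_add, ← T_add, ← T_add] at this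
    exact T_inj this
  obtain rfl : n = 0 := by omega
  obtain rfl : k = 0 := by omega
  simp only [zpow_zero, one_mul] at e
  subst e
  have em2 : g.2.val = Umat a b := by rw [eu]; rfl
  have ha : a ∈ Ok 0 := by have := h1 0 1; rwa [em2] at this
  have hb : b ∈ Ok 0 := by have := h1 0 2; rwa [em2] at this
  have ha' : invert a ∈ Ok 0 := by have := h1 1 2; rwa [em2] at this
  rcases O_invert ha ha' with rfl | rfl
  · rcases D.N'_aux hu hb eu with h | h
    · exact ⟨0, by simpa using h⟩
    · exact ⟨2, h⟩
  · have h3 : (g * D.xw⁻¹).2 = UU 0 (b + 1) := by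
      rw [Prod.snd_mul, eu, Prod.snd_inv]
      change _ * (UU 1 1)⁻¹ = _
      rw [UU_inv, UU_mul]
      congr 1
      · exact CharTwo.add_self_eq_zero _
      · simp only [map_one]; linear_combination two0
    rcases D.N'_aux (mul_mem hu (inv_mem D.x_U')) (add_mem hb (one_mem.mpr le_rfl)) h3 with h | h
    · exact ⟨1, by rw [pow_one]; exact mul_inv_eq_one.mp h⟩
    · exact ⟨3, by rw [pow_succ, ← h]; group⟩

end dat
end Bu

namespace Bu

abbrev V3 : Type := Fin 3 → R2
abbrev LL : Type := AddSubgroup V3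

def act (g : GL3) (L : LL) : LL := L.comap (Matrix.mulVecLin g⁻¹.val).toAddMonoidHom

lemma mem_act {g : GL3} {L : LL} {v : V3} : v ∈ act g L ↔ g⁻¹.val *ᵥ v ∈ L := Iff.rfl

lemma act_one (L : LL) : act 1 L = L := by
  ext v; rw [mem_act, inv_one, Units.val_one, Matrix.one_mulVec]

lemma act_mul (g h : GL3) (L : LL) : act (g * h) L = act g (act h L) := by
  ext v
  rw [mem_act, mem_act, mem_act, _root_.mul_inv_rev, Units.val_mul, Matrix.mulVec_mulVec]

lemma act_le {g : GL3} {L M : LL} (h : L ≤ M) : act g L ≤ act g M := fun _ hv => h hv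

lemma act_inv_act (g : GL3) (L : LL) : act g⁻¹ (act g L) = L := by
  rw [← act_mul, inv_mul_cancel, act_one]
lemma act_act_inv (g : GL3) (L : LL) : act g (act g⁻¹ L) = L := by
  rw [← act_mul, mul_inv_cancel, act_one]

lemma act_le_iff {g : GL3} {L M : LL} : act g L ≤ act g M ↔ L ≤ M := by
  refine ⟨fun h => ?_, act_le⟩
  have := act_le (g := g⁻¹) h
  rwa [act_inv_act, act_inv_act] at this

lemma act_inj {g : GL3} {L M : LL} (h : act g L = act g M) : L = M := by
  rw [← act_inv_act g L, h, act_inv_act]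

lemma smul_mem_act {g : GL3} {L : LL} {v : V3} (h : v ∈ L) : g.val *ᵥ v ∈ act g L := by
  rw [mem_act, Matrix.mulVec_mulVec, ← Units.val_mul, inv_mul_cancel, Units.val_one,
    Matrix.one_mulVec]; exact h

lemma act_tau_comm (n : ℤ) (g : GL3) (L : LL) : act (tau ^ n) (act g L) = act g (act (tau ^ n) L) := by
  rw [← act_mul, ← act_mul, ((tau_comm g).zpow_left n).eq]

def Lat (i j k : ℤ) : LL where
  carrier := {v | v 0 ∈ Ok i ∧ v 1 ∈ Ok j ∧ v 2 ∈ Ok k}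
  zero_mem' := ⟨zero_mem _, zero_mem _, zero_mem _⟩
  add_mem' := fun ha hb => ⟨add_mem ha.1 hb.1, add_mem ha.2.1 hb.2.1, add_mem ha.2.2 hb.2.2⟩
  neg_mem' := fun ha => ⟨neg_mem ha.1, neg_mem ha.2.1, neg_mem ha.2.2⟩

lemma mem_Lat {i j k : ℤ} {v : V3} : v ∈ Lat i j k ↔ v 0 ∈ Ok i ∧ v 1 ∈ Ok j ∧ v 2 ∈ Ok k := Iff.rfl

lemma Lat_le {i j k i' j' k' : ℤ} : Lat i j k ≤ Lat i' j' k' ↔ i' ≤ i ∧ j' ≤ j ∧ k' ≤ k := by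
  constructor
  · intro h
    refine ⟨?_, ?_, ?_⟩
    · have := h (show ![T i, 0, 0] ∈ Lat i j k from ⟨T_mem.mpr le_rfl, zero_mem _, zero_mem _⟩)
      exact T_mem.mp this.1
    · have := h (show ![0, T j, 0] ∈ Lat i j k from ⟨zero_mem _, T_mem.mpr le_rfl, zero_mem _⟩)
      exact T_mem.mp this.2.1
    · have := h (show ![0, 0, T k] ∈ Lat i j k from ⟨zero_mem _, zero_mem _, T_mem.mpr le_rfl⟩)
      exact T_mem.mp this.2.2
  · rintro ⟨h1, h2, h3⟩ v ⟨a, b, c⟩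
    exact ⟨Ok_anti h1 a, Ok_anti h2 b, Ok_anti h3 c⟩

lemma mulVec3 (a b c d e f g h i : R2) (v : V3) :
    !![a, b, c; d, e, f; g, h, i] *ᵥ v =
      ![a * v 0 + b * v 1 + c * v 2, d * v 0 + e * v 1 + f * v 2, g * v 0 + h * v 1 + i * v 2] := by
  ext r
  fin_cases r <;> simp [Matrix.mulVec, dotProduct, Fin.sum_univ_three]

lemma tau_pow_act (n i j k : ℤ) : act (tau ^ n) (Lat i j k) = Lat (i + n) (j + n) (k + n) := by
  ext v
  rw [mem_act, ← _root_.zpow_neg, tau_pow, scalar3, mulVec3, mem_Lat, mem_Lat]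
  simp only [Matrix.cons_val_zero, Matrix.cons_val_one, Matrix.cons_val, zero_mul, zero_add, add_zero,
    T_mul_mem, sub_neg_eq_add]

lemma tau_act (i j k : ℤ) : act tau (Lat i j k) = Lat (i + 1) (j + 1) (k + 1) := by
  have := tau_pow_act 1 i j k
  rwa [zpow_one] at this

lemma Zi_mulVec (v : V3) : Zi *ᵥ v = ![q * v 0, v 1 + v 2, q * v 2] := by
  rw [Zi, mulVec3]; simp

lemma Z_act {i j k : ℤ} (h : j ≤ k + 1) : act Zg (Lat i j k) = Lat (i + 1) j (k + 1) := by
  ext v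
  rw [mem_act]
  change Zi *ᵥ v ∈ _ ↔ _
  rw [Zi_mulVec, mem_Lat, mem_Lat]
  simp only [Matrix.cons_val_zero, Matrix.cons_val_one, Matrix.cons_val, T_mul_mem, sub_neg_eq_add, q]
  constructor
  · rintro ⟨a, b, c⟩
    exact ⟨a, by simpa using sub_mem b (Ok_anti h c), c⟩
  · rintro ⟨a, b, c⟩
    exact ⟨a, add_mem b (Ok_anti h c), c⟩

lemma Zi_act {i j k : ℤ} (h : j ≤ k) : act Zg⁻¹ (Lat i j k) = Lat (i - 1) j (k - 1) := by
  have := Z_act (i := i - 1) (j := j) (k := k - 1) (by omega)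
  rw [sub_add_cancel, sub_add_cancel] at this
  rw [← this, act_inv_act]

abbrev L0 : LL := Lat 0 0 0
abbrev od (d : ℕ) : LL := Lat 0 d d

lemma Y_act : act Yg L0 = Lat 1 0 0 := by
  ext v
  rw [mem_act]
  change Yi *ᵥ v ∈ _ ↔ _
  rw [Yi, mulVec3, mem_Lat, mem_Lat]
  simp only [Matrix.cons_val_zero, Matrix.cons_val_one, Matrix.cons_val, one_mul, zero_mul, add_zero,
    zero_add]
  have e : ((1 + q) * v 0 + v 1) = (v 0 + v 1) + q * v 0 := by ring
  rw [e]
  constructor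
  · rintro ⟨a, b, c⟩
    have h0 : v 0 ∈ Ok 1 := by
      have := sub_mem c a
      rw [add_sub_cancel_left, T_mul_mem] at this
      exact this
    have h1 : v 1 ∈ Ok 0 := by
      have := sub_mem a (Ok_anti (by omega) h0)
      simpa using this
    refine ⟨h0, h1, by simpa using sub_mem b h1⟩
  · rintro ⟨a, b, c⟩
    have h0 : v 0 ∈ Ok 0 := Ok_anti (by omega) a
    exact ⟨add_mem h0 b, add_mem b c, add_mem (add_mem h0 b) (T_mul_mem.mpr a)⟩

lemma Yinv_act : act Yg⁻¹ L0 = Lat 0 0 (-1) := by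
  have : act Yg (Lat 0 0 (-1)) = L0 := by
    ext v
    rw [mem_act]
    change Yi *ᵥ v ∈ _ ↔ _
    rw [Yi, mulVec3, mem_Lat, mem_Lat]
    simp only [Matrix.cons_val_zero, Matrix.cons_val_one, Matrix.cons_val, one_mul, zero_mul, add_zero,
      zero_add]
    have e : ((1 + q) * v 0 + v 1) = (v 0 + v 1) + q * v 0 := by ring
    rw [e]
    constructor
    · rintro ⟨a, b, c⟩
      have h0 : v 0 ∈ Ok 0 := by
        have := sub_mem c (Ok_anti (k := -1) (by omega) a)
        rw [add_sub_cancel_left, T_mul_mem] at this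
        exact this
      have h1 : v 1 ∈ Ok 0 := by
        have := sub_mem a h0
        simpa using this
      refine ⟨h0, h1, by simpa using sub_mem b h1⟩
    · rintro ⟨a, b, c⟩
      exact ⟨add_mem a b, add_mem b c, add_mem (Ok_anti (by omega) (add_mem a b)) (T_mul_mem.mpr a)⟩
  rw [← this, act_inv_act]

lemma Int3_le {g : GL3} (h : act g L0 ≤ L0) : Int3 g := by
  intro i j
  have hv : (Pi.single j 1 : V3) ∈ L0 := by
    refine ⟨?_, ?_, ?_⟩ <;> rw [Pi.single_apply] <;> split_ifs <;>
      first | exact one_mem.mpr le_rfl | exact zero_mem _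
  have := h (smul_mem_act (g := g) hv)
  rw [Matrix.mulVec_single_one] at this
  obtain ⟨h0, h1, h2⟩ := this
  fin_cases i
  · exact h0
  · exact h1
  · exact h2

lemma Int3_of_eq {g : GL3} (h : act g L0 = L0) : Int3 g ∧ Int3 g⁻¹ := by
  refine ⟨Int3_le h.le, Int3_le ?_⟩
  conv_lhs => rw [← h]
  rw [act_inv_act]

/-- unipotent elements act on `od d` when entries are suitably bounded -/
lemma UU_act_le {a b : R2} {i j k : ℤ} (ha : a ∈ Ok (i - j)) (hb : b ∈ Ok (i - k))
    (ha' : invert a ∈ Ok (j - k)) : act (UU a b) (Lat i j k) = Lat i j k := by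
  have key : ∀ b, b ∈ Ok (i - k) → Lat i j k ≤ act (UU a b)⁻¹ (Lat i j k) := by
    intro b hb v hv
    rw [mem_act, inv_inv, UU_val, Umat, mulVec3]
    refine ⟨?_, ?_, ?_⟩
    · simp only [Matrix.cons_val_zero]
      rw [one_mul]
      exact add_mem (add_mem hv.1 (Ok_mul ha hv.2.1 (by omega))) (Ok_mul hb hv.2.2 (by omega))
    · simp only [Matrix.cons_val_one, Matrix.cons_val_zero, zero_mul, zero_add, one_mul]
      exact add_mem hv.2.1 (Ok_mul ha' hv.2.2 (by omega))
    · simp only [Matrix.cons_val, zero_mul, zero_add, one_mul]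
      exact hv.2.2
  apply le_antisymm
  · have h := key (b + a * invert a) (add_mem hb (Ok_mul ha ha' (by omega)))
    rw [UU_inv] at h
    have e : UU a (b + a * invert a + a * invert a) = UU a b := by
      rw [add_assoc, CharTwo.add_self_eq_zero, add_zero]
    rw [e] at h
    have h2 := act_le (g := UU a b) (key b hb)
    rwa [act_act_inv] at h2
  · have h := key (b + a * invert a) (add_mem hb (Ok_mul ha ha' (by omega)))
    rw [UU_inv] at h
    have e : UU a (b + a * invert a + a * invert a) = UU a b := by
      rw [add_assoc, CharTwo.add_self_eq_zero, add_zero]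
    rwa [e] at h

lemma X_act_L0 : act Xg L0 = L0 :=
  UU_act_le (one_mem.mpr le_rfl) (one_mem.mpr le_rfl) (by rw [map_one]; exact one_mem.mpr le_rfl)

lemma Xpow_act_L0 (k : ℕ) : act (Xg ^ k) L0 = L0 := by
  induction k with
  | zero => rw [pow_zero, act_one]
  | succ k ih => rw [pow_succ, act_mul, X_act_L0, ih]

lemma lead_bb (d : ℕ) : lead (-d) (bb d) := by
  cases d with
  | zero => simpa [bb] using (T_zero (R := ZMod 2)) ▸ lead_T 0
  | succ d =>
    have h1 := leadq d
    have h2 := lead_mul lead_q1 (leadqt d)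
    rw [lead_iff] at *
    have e : bb (d + 1) + T (-((d + 1 : ℕ) : ℤ)) = (1 + q) ^ d +
      ((1 + q) * ((1 + q) ^ d * (1 + t) ^ d) + T (-1 + -(d : ℤ))) := by
      rw [show (-((d + 1 : ℕ) : ℤ)) = -1 + -(d : ℤ) by push_cast; ring]
      simp only [bb]; ring
    rw [e]
    refine add_mem (Ok_anti (by omega) (leadq d).1) (Ok_anti (by omega) h2)

lemma lead_tp (d : ℕ) : lead 0 ((1 + t) ^ d) := by
  have := lead_pow lead_t1 d
  rwa [mul_zero] at this

lemma X_n_act (d : ℕ) : act (zs Xg Zg d) (od d) = od d := by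
  rw [X_n]
  refine UU_act_le (Ok_anti (by omega) (leadq d).1) (Ok_anti (by omega) (lead_bb d).1) ?_
  simp only [map_pow, map_add, map_one, invert_q]
  exact Ok_anti (by omega) (lead_tp d).1

end Bu

namespace Bu

section rel
variable {G : Type*} [Group G] (D : Dat G)

abbrev Dat.Q : Type _ := (G × GL3) ⧸ D.GP
def Dat.c (w : G × GL3) : D.Q := QuotientGroup.mk w

lemma Dat.c_eq {a b : G × GL3} : D.c a = D.c b ↔ a⁻¹ * b ∈ D.GP := QuotientGroup.eq

lemma Dat.c_mul {w h : G × GL3} (hh : h ∈ D.GP) : D.c (w * h) = D.c w := by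
  rw [eq_comm, D.c_eq, inv_mul_cancel_left]; exact hh

lemma Dat.c_one {h : G × GL3} : D.c h = D.c 1 ↔ h ∈ D.GP := by
  rw [eq_comm, D.c_eq, inv_one, one_mul]

lemma Dat.c_tw (n : ℤ) (w : G × GL3) : D.c (tw ^ n * w) = D.c w := by
  rw [((tw_comm w).zpow_left n).eq]
  exact D.c_mul (zpow_mem D.t_mem n)

lemma Dat.smul_c (g w : G × GL3) : g • D.c w = D.c (g * w) := rfl

lemma tw_snd (n : ℤ) (w : G × GL3) : (tw ^ n * w).2 = tau ^ n * w.2 := rfl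

def Dat.Vx (A : D.Q) (L : LL) : Prop := ∃ w d, A = D.c w ∧ L = act w.2 (od d)
def Dat.J (A : D.Q) (L : LL) (B : D.Q) (M : LL) : Prop :=
  ∃ w, ∃ n : ℤ, A = D.c w ∧ L = act w.2 L0 ∧ B = D.c (w * D.yw) ∧ M = act (tau ^ n * (w.2 * Yg)) L0
def Dat.Rel (A : D.Q) (L : LL) (B : D.Q) (M : LL) : Prop :=
  (A = B ∧ D.Vx A L ∧ D.Vx A M) ∨ D.J A L B M ∨ D.J B M A L

variable {D} {A B C : D.Q} {L M N : LL}

lemma Rel_symm (h : D.Rel A L B M) : D.Rel B M A L := by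
  rcases h with ⟨rfl, h1, h2⟩ | h | h
  · exact Or.inl ⟨rfl, h2, h1⟩
  · exact Or.inr (Or.inr h)
  · exact Or.inr (Or.inl h)

lemma Vx_smul (g : G × GL3) (h : D.Vx A L) : D.Vx (g • A) (act g.2 L) := by
  obtain ⟨w, d, rfl, rfl⟩ := h
  exact ⟨g * w, d, rfl, by rw [← act_mul]; rfl⟩

lemma Vx_tau (n : ℤ) (h : D.Vx A L) : D.Vx A (act (tau ^ n) L) := by
  obtain ⟨w, d, rfl, rfl⟩ := h
  exact ⟨tw ^ n * w, d, (D.c_tw _ _).symm, by rw [← act_mul]; rfl⟩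

lemma J_smul (g : G × GL3) (h : D.J A L B M) : D.J (g • A) (act g.2 L) (g • B) (act g.2 M) := by
  obtain ⟨w, n, rfl, rfl, rfl, rfl⟩ := h
  refine ⟨g * w, n, rfl, by rw [← act_mul]; rfl, by rw [D.smul_c, mul_assoc], ?_⟩
  have e := ((tau_comm g.2).zpow_left n).eq
  have e2 : g.2 * (tau ^ n * (w.2 * Yg)) = tau ^ n * ((g * w).2 * Yg) := by
    rw [← mul_assoc, ← e, Prod.snd_mul, mul_assoc, mul_assoc]
  rw [← act_mul, e2]

lemma Rel_smul (g : G × GL3) (h : D.Rel A L B M) :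
    D.Rel (g • A) (act g.2 L) (g • B) (act g.2 M) := by
  rcases h with ⟨rfl, h1, h2⟩ | h | h
  · exact Or.inl ⟨rfl, Vx_smul g h1, Vx_smul g h2⟩
  · exact Or.inr (Or.inl (J_smul g h))
  · exact Or.inr (Or.inr (J_smul g h))

lemma Rel_smul_iff (g : G × GL3) :
    D.Rel (g • A) (act g.2 L) (g • B) (act g.2 M) ↔ D.Rel A L B M := by
  refine ⟨fun h => ?_, Rel_smul g⟩
  have := Rel_smul g⁻¹ h
  rwa [inv_smul_smul, inv_smul_smul, Prod.snd_inv, act_inv_act, act_inv_act] at this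

lemma J_mk (w : G × GL3) (a b : ℤ) :
    D.J (D.c w) (act (tau ^ a) (act w.2 L0)) (D.c (w * D.yw)) (act (tau ^ b) (act (w.2 * Yg) L0)) := by
  refine ⟨tw ^ a * w, b - a, (D.c_tw _ _).symm, by rw [← act_mul]; rfl,
    by rw [mul_assoc, D.c_tw], ?_⟩
  rw [← act_mul, tw_snd, mul_assoc (tau ^ a), ← mul_assoc (tau ^ (b - a)), ← _root_.zpow_add,
    sub_add_cancel]

lemma J_tau (a b : ℤ) (h : D.J A L B M) : D.J A (act (tau ^ a) L) B (act (tau ^ b) M) := by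
  obtain ⟨w, n, rfl, rfl, rfl, rfl⟩ := h
  have := J_mk (D := D) w a (b + n)
  rwa [_root_.zpow_add, act_mul, ← act_mul (tau ^ n)] at this

lemma Rel_tau (a b : ℤ) (h : D.Rel A L B M) : D.Rel A (act (tau ^ a) L) B (act (tau ^ b) M) := by
  rcases h with ⟨rfl, h1, h2⟩ | h | h
  · exact Or.inl ⟨rfl, Vx_tau a h1, Vx_tau b h2⟩
  · exact Or.inr (Or.inl (J_tau _ _ h))
  · exact Or.inr (Or.inr (J_tau _ _ h))

lemma J_Vx (h : D.J A L B M) : D.Vx A L ∧ D.Vx B M := by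
  obtain ⟨w, n, rfl, rfl, rfl, rfl⟩ := h
  refine ⟨⟨w, 0, rfl, rfl⟩, ⟨tw ^ n * (w * D.yw), 0, (D.c_tw _ _).symm, rfl⟩⟩

lemma Rel_Vx (h : D.Rel A L B M) : D.Vx A L ∧ D.Vx B M := by
  rcases h with ⟨rfl, h1, h2⟩ | h | h
  · exact ⟨h1, h2⟩
  · exact J_Vx h
  · exact (J_Vx h).symm

lemma GP_em {g : G × GL3} (hg : g ∈ D.GP) :
    ∃ m : ℤ, (∀ f, g.2⁻¹.val *ᵥ ![f, 0, 0] = ![T (-m) * f, 0, 0]) ∧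
      ∀ v : V3, (g.2⁻¹.val *ᵥ v) 2 = T (-m) * v 2 := by
  obtain ⟨n, k, u, hu, e, a, b, c, eu, em⟩ := D.GP_mat (inv_mem hg)
  rw [Prod.snd_inv] at em
  refine ⟨-(n + k), fun f => ?_, fun v => ?_⟩
  · rw [em, mulVec3, neg_neg, T_add]
    change ![T n * T k * f + T n * T k * a * 0 + T n * T k * b * 0, 0 * f + T n * 0 + c * 0,
      0 * f + 0 * 0 + T n * T k * 0] = _
    simp only [mul_zero, zero_mul, add_zero]
  · rw [em, mulVec3, neg_neg, T_add]
    change 0 * v 0 + 0 * v 1 + T n * T k * v 2 = _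
    simp only [zero_mul, zero_add]

lemma od_zero : od 0 = L0 := by
  change Lat 0 ((0 : ℕ) : ℤ) ((0 : ℕ) : ℤ) = _
  rw [Nat.cast_zero]

lemma tau_od_zero (k : ℕ) : act tau (od 0) = act (Xg ^ k) (Lat 1 1 1) := by
  have := act_tau_comm 1 (Xg ^ k) L0
  rw [Xpow_act_L0, zpow_one, tau_act] at this
  rw [od_zero, tau_act]
  exact this

lemma e_mem_od (d : ℕ) : (![1, 0, 0] : V3) ∈ od d := ⟨one_mem.mpr le_rfl, zero_mem _, zero_mem _⟩

lemma key_d0 {g : G × GL3} (hg : g ∈ D.GP) {d : ℕ} (h : act g.2 L0 = od d) : d = 0 := by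
  obtain ⟨m, h1, h2⟩ := GP_em hg
  have hm : m ≤ 0 := by
    have := e_mem_od d
    rw [← h, mem_act, h1] at this
    have := this.1
    change T (-m) * 1 ∈ _ at this
    rw [mul_one, T_mem] at this
    omega
  have h3 : g.2.val *ᵥ ![0, 0, 1] ∈ od d := by
    rw [← h]; exact smul_mem_act ⟨zero_mem _, zero_mem _, one_mem.mpr le_rfl⟩
  have h4 := h2 (g.2.val *ᵥ ![0, 0, 1])
  rw [Matrix.mulVec_mulVec, ← Units.val_mul, inv_mul_cancel, Units.val_one, Matrix.one_mulVec] at h4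
  change (1 : R2) = _ at h4
  have h5 : (1 : R2) ∈ Ok (d - m) := by
    rw [h4, T_mul_mem]
    exact Ok_anti (by omega) h3.2.2
  have := one_mem.mp h5
  omega

lemma key_x {g : G × GL3} (hg : g ∈ D.GP) {d : ℕ} (h : act g.2 L0 = od d) :
    d = 0 ∧ ∃ k : ℕ, g = D.xw ^ k := by
  obtain rfl := key_d0 hg h
  have := Int3_of_eq (g := g.2) (by rw [h, od_zero])
  exact ⟨rfl, D.N' hg this.1 this.2⟩

lemma near (h : D.Vx (D.c 1) L) (hL : L ≤ L0) :
    (![1, 0, 0] : V3) ∈ L ∨ ∀ v ∈ L, v 2 ∈ Ok 1 := by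
  obtain ⟨w, d, hw, rfl⟩ := h
  have hw := D.c_one.mp hw.symm
  obtain ⟨m, h1, h2⟩ := GP_em hw
  have h0 : (![T m, 0, 0] : V3) ∈ act w.2 (od d) := by
    rw [mem_act, h1, ← T_add, neg_add_cancel, T_zero]
    exact e_mem_od d
  have hm : 0 ≤ m := T_mem.mp (hL h0).1
  rcases hm.eq_or_lt with rfl | hm
  · left; rwa [T_zero] at h0
  · right
    intro v hv
    have := (mem_act.mp hv).2.2
    rw [h2, T_mul_mem] at this
    exact Ok_anti (by omega) this

lemma xw_pow_snd (k : ℕ) : (D.xw ^ k).2 = Xg ^ k := rfl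

lemma CA {d : ℕ} (h : D.Rel A L (D.c 1) (od d)) (h1 : act tau (od d) ≤ L) (h2 : L ≤ od d) :
    (A = D.c 1 ∧ D.Vx (D.c 1) L) ∨ (d = 0 ∧ ∃ k : ℕ,
      (A = D.c (D.xw ^ k * D.yw) ∧ L = act (Xg ^ k) (Lat 1 0 0)) ∨
      (A = D.c (D.xw ^ k * D.yw⁻¹) ∧ L = act (Xg ^ k) (Lat 1 1 0))) := by
  rcases h with ⟨rfl, h, _⟩ | ⟨w, n, rfl, rfl, h3, h4⟩ | ⟨w, n, h3, h4, rfl, rfl⟩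
  · exact Or.inl ⟨rfl, h⟩
  · right
    have hg : tw ^ n * (w * D.yw) ∈ D.GP :=
      mul_mem (zpow_mem D.t_mem _) (D.c_one.mp h3.symm)
    obtain ⟨rfl, k, hk⟩ := key_x hg h4.symm
    refine ⟨rfl, k, Or.inr ?_⟩
    have ew : w = tw ^ (-n) * (D.xw ^ k * D.yw⁻¹) := by rw [← hk]; group
    have eL : act w.2 L0 = act (Xg ^ k) (Lat (-n) (-n) (-n-1)) := by
      rw [ew, tw_snd, Prod.snd_mul, xw_pow_snd, act_mul, act_mul, act_tau_comm, Prod.snd_inv, Yinv_act,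
        tau_pow_act]
      simp only [zero_add]
      rw [neg_add_eq_sub, sub_eq_add_neg, add_comm, ← sub_eq_add_neg]
    rw [eL] at h1 h2
    have e0 : act tau (od 0) = act (Xg ^ k) (Lat 1 1 1) := tau_od_zero k
    have e1 : (od 0) = act (Xg ^ k) (Lat 0 0 0) := (Xpow_act_L0 k).symm
    rw [e0, act_le_iff, Lat_le] at h1
    rw [e1, act_le_iff, Lat_le] at h2
    obtain rfl : n = -1 := by omega
    exact ⟨by rw [ew, D.c_tw], eL⟩
  · right
    obtain ⟨rfl, k, rfl⟩ := key_x (D.c_one.mp h3.symm) h4.symm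
    refine ⟨rfl, k, Or.inl ?_⟩
    have eL : act (tau ^ n * ((D.xw ^ k).2 * Yg)) L0 = act (Xg ^ k) (Lat (1 + n) n n) := by
      rw [xw_pow_snd, act_mul, act_mul, act_tau_comm, Y_act,
        tau_pow_act]
      simp only [zero_add]
    rw [eL] at h1 h2 ⊢
    have e0 : act tau (od 0) = act (Xg ^ k) (Lat 1 1 1) := tau_od_zero k
    have e1 : (od 0) = act (Xg ^ k) (Lat 0 0 0) := (Xpow_act_L0 k).symm
    rw [e0, act_le_iff, Lat_le] at h1
    rw [e1, act_le_iff, Lat_le] at h2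
    obtain rfl : n = 0 := by omega
    exact ⟨rfl, by simp⟩

/-- transport a vertex to the standard position -/
lemma Vx_std (h : D.Vx B M) : ∃ g : G × GL3, ∃ d, g • B = D.c 1 ∧ act g.2 M = od d := by
  obtain ⟨w, d, rfl, rfl⟩ := h
  refine ⟨w⁻¹, d, ?_, ?_⟩
  · rw [D.smul_c, inv_mul_cancel]
  · rw [Prod.snd_inv, act_inv_act]

lemma tau_od_le (d : ℕ) : act tau (od d) ≤ od d := by
  rw [tau_act, Lat_le]; omega

lemma relU (h : D.Rel A L B L) : A = B := by
  obtain ⟨g, d, e1, e2⟩ := Vx_std (Rel_Vx h).2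
  have h := Rel_smul g h
  rw [e1, e2] at h
  suffices g • A = D.c 1 by
    rw [← e1] at this; exact MulAction.injective g this
  rcases CA h (tau_od_le d) le_rfl with h | ⟨rfl, k, h | h⟩
  · exact h.1
  · have := h.2
    rw [show od 0 = act (Xg ^ k) (Lat 0 0 0) from (Xpow_act_L0 k).symm] at this
    have := Lat_le.mp (act_inj this).le
    omega
  · have := h.2
    rw [show od 0 = act (Xg ^ k) (Lat 0 0 0) from (Xpow_act_L0 k).symm] at this
    have := Lat_le.mp (act_inj this).le
    omega

end rel
end Bu

namespace Bu

section rel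
variable {G : Type*} [Group G] {D : Dat G} {A B C : D.Q} {L M N : LL}

lemma Lat_mid {i j k : ℤ} (h1 : Lat i (j + 1) k ≤ L) (h2 : L ≤ Lat i j k) :
    L = Lat i (j + 1) k ∨ L = Lat i j k := by
  by_cases h : L ≤ Lat i (j + 1) k
  · exact Or.inl (le_antisymm h h1)
  · right
    obtain ⟨v, hv, hv2⟩ := SetLike.not_le_iff_exists.mp h
    have hv' := h2 hv
    have h3 : v 1 + T j ∈ Ok (j + 1) := by
      rcases Ok_succ hv'.2.1 with h | h
      · exact absurd ⟨hv'.1, h, hv'.2.2⟩ hv2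
      · exact h
    refine le_antisymm h2 fun w hw => ?_
    rcases Ok_succ hw.2.1 with h | h
    · exact h1 ⟨hw.1, h, hw.2.2⟩
    · have h4 : w - v ∈ L := h1 ⟨sub_mem hw.1 hv'.1, by
        have := sub_mem h h3
        rw [add_sub_add_right_eq_sub] at this
        exact this, sub_mem hw.2.2 hv'.2.2⟩
      have := add_mem h4 hv
      rwa [sub_add_cancel] at this

lemma X2 : Xg ^ 2 = UU 0 1 := by
  rw [pow_two, Xg, UU_mul, map_one]
  rw [CharTwo.add_self_eq_zero, one_mul, zero_add]

lemma X3 : Xg ^ 3 = UU 1 0 := by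
  rw [pow_succ, X2, Xg, UU_mul, map_one, zero_add, zero_mul, add_zero, CharTwo.add_self_eq_zero]

lemma UU_mulVec (a b : R2) (v : V3) :
    (UU a b).val *ᵥ v = ![v 0 + a * v 1 + b * v 2, v 1 + invert a * v 2, v 2] := by
  rw [UU_val, Umat, mulVec3]
  simp only [one_mul, zero_mul, zero_add]

lemma f_img {a b : R2} {i k : ℤ} (h : act (UU a b) (Lat i 0 k) ≤ M) : (![a, 1, 0] : V3) ∈ M := by
  have h1 : (![0, 1, 0] : V3) ∈ Lat i 0 k := ⟨zero_mem _, one_mem.mpr le_rfl, zero_mem _⟩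
  have := h (smul_mem_act (g := UU a b) h1)
  rw [UU_mulVec] at this
  convert this using 1
  change _ = ![0 + a * 1 + b * 0, 1 + invert a * 0, 0]
  simp only [mul_zero, mul_one, add_zero, zero_add]

lemma g_img {a b : R2} {i j : ℤ} (h : act (UU a b) (Lat i j 0) ≤ M) :
    (![b, invert a, 1] : V3) ∈ M := by
  have h1 : (![0, 0, 1] : V3) ∈ Lat i j 0 := ⟨zero_mem _, zero_mem _, one_mem.mpr le_rfl⟩
  have := h (smul_mem_act (g := UU a b) h1)
  rw [UU_mulVec] at this
  convert this using 1
  change _ = ![0 + a * 0 + b * 1, 0 + invert a * 1, 1]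
  simp only [mul_zero, mul_one, add_zero, zero_add]

lemma not1 : (1 : R2) ∉ Ok 1 := by rw [one_mem]; omega

lemma x_pow_mod (k : ℕ) : D.xw ^ k = D.xw ^ (k % 4) := by
  conv_lhs => rw [← Nat.div_add_mod k 4, pow_add, pow_mul, D.x4, one_pow, one_mul]

lemma ff1 {k : ℕ} (hk : k < 4) (h : act (Xg ^ k) (Lat 1 0 0) ≤ Lat 1 0 0) : k = 0 := by
  interval_cases k
  · rfl
  · rw [pow_one] at h
    exact absurd (f_img h).1 not1
  · rw [X2] at h
    exact absurd (g_img h).1 not1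
  · rw [X3] at h
    exact absurd (f_img h).1 not1

lemma ff2 {k : ℕ} (hk : k < 4) (h : act (Xg ^ k) (Lat 1 1 0) ≤ Lat 1 1 0) : k = 0 := by
  interval_cases k
  · rfl
  · rw [pow_one] at h
    exact absurd (g_img h).1 not1
  · rw [X2] at h
    exact absurd (g_img h).1 not1
  · rw [X3] at h
    have := (g_img h).2.1
    rw [map_one] at this
    exact absurd this not1

lemma ff3 {k : ℕ} (hk : k < 4) (h : act (Xg ^ k) (Lat 1 1 0) ≤ Lat 1 0 0) : k = 0 ∨ k = 3 := by
  interval_cases k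
  · exact Or.inl rfl
  · rw [pow_one] at h
    exact absurd (g_img h).1 not1
  · rw [X2] at h
    exact absurd (g_img h).1 not1
  · exact Or.inr rfl

lemma ff4 {k : ℕ} (hk : k < 4) (h : act (Xg ^ k) (Lat 1 0 0) ≤ Lat 1 1 0) : False := by
  interval_cases k
  · rw [pow_zero, act_one, Lat_le] at h; omega
  · rw [pow_one] at h
    exact absurd (f_img h).2.1 not1
  · rw [X2] at h
    exact absurd (f_img h).2.1 not1
  · rw [X3] at h
    exact absurd (f_img h).2.1 not1

lemma Rel_mk (w : G × GL3) (a b : ℤ) (hA : A = D.c w) (hL : L = act (tau ^ a) (act w.2 L0))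
    (hB : B = D.c (w * D.yw)) (hM : M = act (tau ^ b) (act (w.2 * Yg) L0)) : D.Rel A L B M := by
  subst hA hL hB hM
  exact Or.inr (Or.inl (J_mk w a b))

lemma act_t0 : act (tau ^ (0 : ℤ)) L = L := by rw [zpow_zero, act_one]

/-- near, `[1]` at `Lat i i i`, vs `y` -/
lemma bas1 (i : ℤ) : D.Rel (D.c 1) (Lat i i i) (D.c D.yw) (Lat 1 0 0) := by
  refine Rel_mk 1 i 0 rfl ?_ (by rw [one_mul]) ?_
  · rw [Prod.snd_one, act_one, tau_pow_act]; simp only [zero_add]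
  · rw [act_t0, Prod.snd_one, one_mul, Y_act]

lemma bas2 : D.Rel (D.c D.yw) (Lat 1 0 0) (D.c 1) (Lat 1 0 1) := by
  refine Rel_mk (D.yw * D.xw) 0 0 (D.c_mul D.x_mem).symm ?_ ?_ ?_
  · rw [act_t0, Prod.snd_mul, act_mul, X_act_L0, Y_act]
  · rw [← D.zw_eq]; exact (D.c_one.mpr D.z_mem).symm
  · rw [act_t0, Prod.snd_mul, YXY, Z_act (by omega)]; rfl

lemma bas3 (i : ℤ) : D.Rel (D.c D.yw⁻¹) (Lat 1 1 0) (D.c 1) (Lat i i i) := by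
  refine Rel_mk D.yw⁻¹ 1 i rfl ?_ (by rw [inv_mul_cancel]) ?_
  · rw [Prod.snd_inv, Yinv_act, tau_pow_act]; rfl
  · rw [Prod.snd_inv, inv_mul_cancel, act_one, tau_pow_act]; simp only [zero_add]

lemma zy : D.zw⁻¹ * D.yw = D.yw⁻¹ * D.xw⁻¹ := by rw [D.zw_eq]; group

lemma bas4 : D.Rel (D.c 1) (Lat 0 1 0) (D.c D.yw⁻¹) (Lat 1 1 0) := by
  refine Rel_mk D.zw⁻¹ 1 1 (D.c_one.mpr (inv_mem D.z_mem)).symm ?_ ?_ ?_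
  · rw [Prod.snd_inv]
    change _ = act _ (act Zg⁻¹ _)
    rw [Zi_act le_rfl, tau_pow_act]; rfl
  · rw [zy, D.c_mul (inv_mem D.x_mem)]
  · have e : D.zw⁻¹.2 * Yg = Yg⁻¹ * Xg⁻¹ := congrArg Prod.snd (zy (D := D))
    have e2 : act Xg⁻¹ L0 = L0 := by
      conv_lhs => rw [← X_act_L0, act_inv_act]
    rw [e, act_mul, e2, Yinv_act, tau_pow_act]; rfl

lemma bas5 : D.Rel (D.c D.yw) (Lat 1 0 0) (D.c D.yw⁻¹) (Lat 1 1 0) := by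
  have h : D.yw * D.yw = tw * D.yw⁻¹ := by rw [← D.y3]; group
  refine Rel_mk D.yw 0 0 rfl ?_ ?_ ?_
  · rw [act_t0, Y_act]
  · have := D.c_tw 1 D.yw⁻¹
    rw [zpow_one] at this
    rw [h, this]
  · have e : Yg * Yg = tau * Yg⁻¹ := congrArg Prod.snd h
    rw [act_t0, e, act_mul, Yinv_act, tau_act]; rfl

lemma bas6 : D.c (D.xw ^ 3 * D.yw⁻¹) = D.c D.yw := by
  have h : D.xw ^ 3 * D.yw⁻¹ = D.xw ^ 4 * D.yw * D.zw⁻¹ := by rw [D.zw_eq]; group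
  rw [h, D.x4, one_mul, D.c_mul (inv_mem D.z_mem)]

/-- near below far -/
lemma nf (h : D.Vx (D.c 1) L) (h0 : Lat 1 1 1 ≤ L) :
    (L ≤ Lat 1 0 0 → D.Rel (D.c 1) L (D.c D.yw) (Lat 1 0 0)) ∧
    (L ≤ Lat 1 1 0 → D.Rel (D.c 1) L (D.c D.yw⁻¹) (Lat 1 1 0)) := by
  refine ⟨fun hL => ?_, fun hL => ?_⟩
  · rcases near h (hL.trans (Lat_le.mpr (by omega))) with h1 | h1
    · exact absurd (hL h1).1 not1
    · rcases Lat_mid (i := 1) (j := 0) (k := 1) h0 (fun v hv => ⟨(hL hv).1, (hL hv).2.1, h1 v hv⟩) with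
        rfl | rfl
      · exact bas1 1
      · exact Rel_symm bas2
  · rcases near h (hL.trans (Lat_le.mpr (by omega))) with h1 | h1
    · exact absurd (hL h1).1 not1
    · obtain rfl : L = Lat 1 1 1 :=
        le_antisymm (fun v hv => ⟨(hL hv).1, (hL hv).2.1, h1 v hv⟩) h0
      exact Rel_symm (bas3 1)

/-- near above far -/
lemma fn (h : D.Vx (D.c 1) L) (h0 : L ≤ L0) :
    (Lat 1 0 0 ≤ L → D.Rel (D.c D.yw) (Lat 1 0 0) (D.c 1) L) ∧
    (Lat 1 1 0 ≤ L → D.Rel (D.c D.yw⁻¹) (Lat 1 1 0) (D.c 1) L) := by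
  have he : Lat 1 1 0 ≤ L → Lat 0 1 0 ≤ L := by
    intro hL v hv
    have hg : (![0, 0, 1] : V3) ∈ L := hL ⟨zero_mem _, zero_mem _, one_mem.mpr le_rfl⟩
    rcases near h h0 with h1 | h1
    · rcases Ok_succ hv.1 with h2 | h2
      · exact hL ⟨h2, hv.2.1, hv.2.2⟩
      · have h3 : v + ![1, 0, 0] ∈ L := hL ⟨by rw [← T_zero]; exact h2,
          add_mem hv.2.1 (zero_mem _), add_mem hv.2.2 (zero_mem _)⟩
        have := sub_mem h3 h1
        rwa [add_sub_cancel_right] at this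
    · exact absurd (h1 _ hg) not1
  refine ⟨fun hL => ?_, fun hL => ?_⟩
  · have h1 := he ((Lat_le.mpr (by omega)).trans hL)
    obtain rfl : L = L0 := by
      rcases Lat_mid (i := 0) (j := 0) (k := 0) h1 h0 with rfl | rfl
      · have := Lat_le.mp hL; omega
      · rfl
    exact Rel_symm (bas1 0)
  · rcases Lat_mid (i := 0) (j := 0) (k := 0) (he hL) h0 with rfl | rfl
    · exact Rel_symm bas4
    · exact bas3 0

lemma x_c1 (k : ℕ) : (D.xw ^ k)⁻¹ • D.c 1 = D.c 1 := by
  rw [D.smul_c, D.c_one, mul_one]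
  exact inv_mem (pow_mem D.x_mem k)

lemma Xinv_L0 (k : ℕ) : act (Xg ^ k)⁻¹ L0 = L0 := by
  conv_lhs => rw [← Xpow_act_L0 k, act_inv_act]

lemma Xinv_L1 (k : ℕ) : act (Xg ^ k)⁻¹ (Lat 1 1 1) = Lat 1 1 1 := by
  have h := tau_od_zero k
  rw [od_zero, tau_act] at h
  have h : Lat 1 1 1 = act (Xg ^ k) (Lat 1 1 1) := h
  conv_lhs => rw [h, act_inv_act]

lemma relT0 {d : ℕ} (h1 : act tau (od d) ≤ L) (h2 : L ≤ N) (h3 : N ≤ od d)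
    (hA : D.Rel A L (D.c 1) (od d)) (hC : D.Rel C N (D.c 1) (od d)) : D.Rel A L C N := by
  have vA := (Rel_Vx hA).1
  have vC := (Rel_Vx hC).1
  rcases CA hA h1 (h2.trans h3) with ⟨rfl, hL⟩ | ⟨rfl, k, hk⟩
  · rcases CA hC (h1.trans h2) h3 with ⟨rfl, hN⟩ | ⟨rfl, k, hk⟩
    · exact Or.inl ⟨rfl, hL, hN⟩
    · rw [od_zero, tau_act] at h1
      have h1 := act_le (g := (Xg ^ k)⁻¹) (show Lat 1 1 1 ≤ L from h1)
      rw [Xinv_L1] at h1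
      have h2 := act_le (g := (Xg ^ k)⁻¹) h2
      have hL := Vx_smul (D.xw ^ k)⁻¹ hL
      rw [x_c1, Prod.snd_inv, xw_pow_snd] at hL
      rw [← Rel_smul_iff (D.xw ^ k)⁻¹, x_c1, Prod.snd_inv, xw_pow_snd]
      rcases hk with ⟨rfl, rfl⟩ | ⟨rfl, rfl⟩
      · rw [D.smul_c, inv_mul_cancel_left]
        rw [act_inv_act] at h2 ⊢
        exact (nf hL h1).1 h2
      · rw [D.smul_c, inv_mul_cancel_left]
        rw [act_inv_act] at h2 ⊢
        exact (nf hL h1).2 h2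
  · rcases CA hC (h1.trans h2) h3 with ⟨rfl, hN⟩ | ⟨-, l, hl⟩
    · rw [od_zero] at h3
      have h3 := act_le (g := (Xg ^ k)⁻¹) h3
      rw [Xinv_L0] at h3
      have h2 := act_le (g := (Xg ^ k)⁻¹) h2
      have hL := Vx_smul (D.xw ^ k)⁻¹ hN
      rw [x_c1, Prod.snd_inv, xw_pow_snd] at hL
      rw [← Rel_smul_iff (D.xw ^ k)⁻¹, x_c1, Prod.snd_inv, xw_pow_snd]
      rcases hk with ⟨rfl, rfl⟩ | ⟨rfl, rfl⟩
      · rw [D.smul_c, inv_mul_cancel_left]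
        rw [act_inv_act] at h2 ⊢
        exact (fn hL h3).1 h2
      · rw [D.smul_c, inv_mul_cancel_left]
        rw [act_inv_act] at h2 ⊢
        exact (fn hL h3).2 h2
    · obtain ⟨m, hm, em⟩ : ∃ m < 4, (D.xw ^ l)⁻¹ * D.xw ^ k = D.xw ^ m := by
        refine ⟨(k + 3 * l) % 4, Nat.mod_lt _ (by omega), ?_⟩
        rw [← x_pow_mod, inv_mul_eq_iff_eq_mul, ← pow_add, x_pow_mod, x_pow_mod (l + _)]
        congr 1; omega
      have em2 : (Xg ^ l)⁻¹ * Xg ^ k = Xg ^ m := congrArg Prod.snd em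
      have h2 := act_le (g := (Xg ^ l)⁻¹) h2
      have vA := Vx_smul (D.xw ^ l)⁻¹ vA
      have vC := Vx_smul (D.xw ^ l)⁻¹ vC
      rw [Prod.snd_inv, xw_pow_snd] at vA vC
      rw [← Rel_smul_iff (D.xw ^ l)⁻¹, Prod.snd_inv, xw_pow_snd]
      rcases hk with ⟨rfl, rfl⟩ | ⟨rfl, rfl⟩ <;> rcases hl with ⟨rfl, rfl⟩ | ⟨rfl, rfl⟩ <;>
        rw [D.smul_c, inv_mul_cancel_left, act_inv_act] at vC <;>
        rw [D.smul_c, ← mul_assoc, em, ← act_mul, em2] at vA <;>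
        rw [D.smul_c, D.smul_c, inv_mul_cancel_left, act_inv_act, ← mul_assoc, em, ← act_mul, em2] <;>
        rw [← act_mul, em2, act_inv_act] at h2
      · obtain rfl := ff1 hm h2
        rw [pow_zero, one_mul, pow_zero, act_one] at vA ⊢
        exact Or.inl ⟨rfl, vA, vC⟩
      · exact (ff4 hm h2).elim
      · rcases ff3 hm h2 with rfl | rfl
        · rw [pow_zero, one_mul, pow_zero, act_one]
          exact Rel_symm bas5
        · rw [bas6] at vA ⊢
          exact Or.inl ⟨rfl, vA, vC⟩
      · obtain rfl := ff2 hm h2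
        rw [pow_zero, one_mul, pow_zero, act_one] at vA ⊢
        exact Or.inl ⟨rfl, vA, vC⟩

lemma act_tau1 (g : GL3) (L : LL) : act tau (act g L) = act g (act tau L) := by
  have := act_tau_comm 1 g L
  rwa [zpow_one] at this

lemma relT (h1 : act tau M ≤ L) (h2 : L ≤ N) (h3 : N ≤ M)
    (hA : D.Rel A L B M) (hC : D.Rel C N B M) : D.Rel A L C N := by
  obtain ⟨g, d, e1, e2⟩ := Vx_std (Rel_Vx hA).2
  rw [← Rel_smul_iff g] at hA hC ⊢
  rw [e1, e2] at hA hC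
  refine relT0 (d := d) ?_ (act_le h2) (e2 ▸ act_le h3) hA hC
  rw [← e2, act_tau1]; exact act_le h1

end rel
end Bu

namespace Bu

section rel
variable {G : Type*} [Group G] {D : Dat G} {A B C : D.Q} {L M N : LL}

def CoordP (s1 s2 s3 s4 s5 s6 s7 : Prop) : Prop :=
  (s4 → s1 ∧ s2) ∧ (s5 → s1 ∧ s3) ∧ (s6 → s2 ∧ s3) ∧ (s7 → s1 ∧ s2 ∧ s3)

def LineP (a b c : Prop) : Prop := (a → b → c) ∧ (a → c → b) ∧ (b → c → a)

lemma comb (s1 s2 s3 s4 s5 s6 s7 : Prop) (h1 : LineP s1 s2 s4) (h2 : LineP s1 s3 s5)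
    (h3 : LineP s2 s3 s6) (h4 : LineP s1 s6 s7) (h5 : LineP s2 s5 s7) (h6 : LineP s3 s4 s7)
    (h7 : LineP s4 s5 s6) :
    CoordP s1 s2 s3 s4 s5 s6 s7 ∨ CoordP s1 s4 s7 s2 s6 s3 s5 ∨
    CoordP s1 s2 s5 s4 s3 s7 s6 ∨ CoordP s1 s4 s6 s2 s7 s5 s3 := by
  unfold CoordP LineP at *
  by_cases a1 : s1 <;> by_cases a2 : s2 <;> by_cases a3 : s3 <;> by_cases a4 : s4 <;>
    by_cases a5 : s5 <;> by_cases a6 : s6 <;> simp_all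

abbrev ve : V3 := ![1, 0, 0]
abbrev vf (d : ℕ) : V3 := ![0, T d, 0]
abbrev vg (d : ℕ) : V3 := ![0, 0, T d]

lemma vv (v : V3) : v + v = 0 := by
  funext i; exact CharTwo.add_self_eq_zero (v i)

lemma mem_cong {K : LL} (h : K ≤ L) {v w : V3} (hv : v + w ∈ K) : v ∈ L ↔ w ∈ L := by
  have := h hv
  constructor
  · intro hw
    have := sub_mem this hw
    rwa [add_sub_cancel_left] at this
  · intro hw
    have := sub_mem this hw
    rwa [add_sub_cancel_right] at this

lemma line (u v w : V3) (h : u + v + w = 0) : LineP (u ∈ L) (v ∈ L) (w ∈ L) := by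
  refine ⟨fun a b => ?_, fun a b => ?_, fun a b => ?_⟩
  · have : w = -(u + v) := by rw [eq_neg_iff_add_eq_zero, add_comm]; exact h
    rw [this]; exact neg_mem (add_mem a b)
  · have : v = -(u + w) := by rw [eq_neg_iff_add_eq_zero, ← h]; abel
    rw [this]; exact neg_mem (add_mem a b)
  · have : u = -(v + w) := by rw [eq_neg_iff_add_eq_zero, ← h]; abel
    rw [this]; exact neg_mem (add_mem a b)

lemma v2 (v : V3) : (2 : ℤ) • v = 0 := by rw [two_smul, vv]

lemma combL (e f g : V3) :
    CoordP (e ∈ L) (f ∈ L) (g ∈ L) (e + f ∈ L) (e + g ∈ L) (f + g ∈ L) (e + f + g ∈ L) ∨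
    CoordP (e ∈ L) (e + f ∈ L) (e + f + g ∈ L) (f ∈ L) (f + g ∈ L) (g ∈ L) (e + g ∈ L) ∨
    CoordP (e ∈ L) (f ∈ L) (e + g ∈ L) (e + f ∈ L) (g ∈ L) (e + f + g ∈ L) (f + g ∈ L) ∨
    CoordP (e ∈ L) (e + f ∈ L) (f + g ∈ L) (f ∈ L) (e + f + g ∈ L) (e + g ∈ L) (g ∈ L) := by
  have he := v2 e
  have hf := v2 f
  have hg := v2 g
  apply comb <;> apply line
  · linear_combination (exp := 1) he + hf
  · linear_combination (exp := 1) he + hg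
  · linear_combination (exp := 1) hf + hg
  · linear_combination (exp := 1) he + hf + hg
  · linear_combination (exp := 1) he + hf + hg
  · linear_combination (exp := 1) he + hf + hg
  · linear_combination (exp := 1) he + hf + hg

lemma tau_od (d : ℕ) : act tau (od d) = Lat 1 (d + 1) (d + 1) := by rw [tau_act]; rfl

lemma Xe (d : ℕ) : (zs Xg Zg d).val *ᵥ ve + ve ∈ act tau (od d) := by
  rw [X_n, UU_mulVec, tau_od]
  refine ⟨?_, ?_, ?_⟩
  · change (1 : R2) + (1 + q) ^ d * 0 + bb d * 0 + 1 ∈ _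
    rw [mul_zero, mul_zero, add_zero, add_zero, CharTwo.add_self_eq_zero]; exact zero_mem _
  · change (0 : R2) + invert ((1 + q) ^ d) * 0 + 0 ∈ _
    rw [mul_zero, add_zero, add_zero]; exact zero_mem _
  · change (0 : R2) + 0 ∈ _
    rw [add_zero]; exact zero_mem _

lemma lead_scale {d : ℕ} {f : R2} (h : lead (-d) f) : f * T d + 1 ∈ Ok 1 := by
  have h := lead_iff.mp h
  have e : f * T d + 1 = T d * (f + T (-d)) := by
    rw [mul_add, ← T_add, add_neg_cancel, T_zero, mul_comm]
  rw [e, T_mul_mem]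
  exact Ok_anti (by omega) h

lemma Xf (d : ℕ) : (zs Xg Zg d).val *ᵥ vf d + (ve + vf d) ∈ act tau (od d) := by
  rw [X_n, UU_mulVec, tau_od]
  refine ⟨?_, ?_, ?_⟩
  · change 0 + (1 + q) ^ d * T d + _ * 0 + (1 + 0) ∈ _
    rw [mul_zero, add_zero, add_zero, zero_add]
    exact lead_scale (leadq d)
  · change T d + _ * 0 + (0 + T d) ∈ _
    rw [mul_zero, add_zero, zero_add, CharTwo.add_self_eq_zero]; exact zero_mem _
  · change (0 : R2) + (0 + 0) ∈ _
    rw [add_zero, add_zero]; exact zero_mem _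

lemma Xg_ (d : ℕ) : (zs Xg Zg d).val *ᵥ vg d + (ve + vf d + vg d) ∈ act tau (od d) := by
  rw [X_n, UU_mulVec, tau_od]
  refine ⟨?_, ?_, ?_⟩
  · change 0 + _ * 0 + bb d * T d + (1 + 0 + 0) ∈ _
    rw [mul_zero, add_zero, add_zero, add_zero, zero_add]
    exact lead_scale (lead_bb d)
  · change 0 + invert ((1 + q) ^ d) * T d + (0 + T d + 0) ∈ _
    have h := lead_iff.mp (lead_tp d)
    have e : 0 + invert ((1 + q) ^ d) * T d + (0 + T d + 0) = T d * ((1 + t) ^ d + T 0) := by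
      simp only [map_pow, map_add, map_one, invert_q, T_zero]; ring
    rw [e, T_mul_mem]
    exact Ok_anti (by omega) h
  · change T d + (0 + 0 + T d) ∈ _
    rw [add_zero, zero_add, CharTwo.add_self_eq_zero]; exact zero_mem _

lemma stepL {d : ℕ} (h : act tau (od d) ≤ L) :
    (ve ∈ act (zs Xg Zg d)⁻¹ L ↔ ve ∈ L) ∧
    (vf d ∈ act (zs Xg Zg d)⁻¹ L ↔ ve + vf d ∈ L) ∧
    (vg d ∈ act (zs Xg Zg d)⁻¹ L ↔ ve + vf d + vg d ∈ L) ∧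
    (ve + vf d ∈ act (zs Xg Zg d)⁻¹ L ↔ vf d ∈ L) ∧
    (ve + vg d ∈ act (zs Xg Zg d)⁻¹ L ↔ vf d + vg d ∈ L) ∧
    (vf d + vg d ∈ act (zs Xg Zg d)⁻¹ L ↔ vg d ∈ L) ∧
    (ve + vf d + vg d ∈ act (zs Xg Zg d)⁻¹ L ↔ ve + vg d ∈ L) := by
  have he := Xe d
  have hf := Xf d
  have hg := Xg_ d
  have ze := v2 ve
  have zf := v2 (vf d)
  have zg := v2 (vg d)
  simp only [mem_act, inv_inv, Matrix.mulVec_add]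
  generalize ve = e, vf d = f, vg d = g at *
  generalize (zs Xg Zg d).val *ᵥ e = e', (zs Xg Zg d).val *ᵥ f = f', (zs Xg Zg d).val *ᵥ g = g' at *
  refine ⟨mem_cong h he, mem_cong h hf, mem_cong h hg, mem_cong h ?_, mem_cong h ?_, mem_cong h ?_,
    mem_cong h ?_⟩
  · have := add_mem he hf
    convert this using 1
    linear_combination (exp := 1) -ze
  · have := add_mem he hg
    convert this using 1
    linear_combination (exp := 1) -ze
  · have := add_mem hf hg
    convert this using 1
    linear_combination (exp := 1) -ze - zf
  · have := add_mem (add_mem he hf) hg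
    convert this using 1
    linear_combination (exp := 1) -ze - zf

lemma resid {d : ℕ} {v : V3} (hv : v ∈ od d) : ∃ a b c : V3,
    (a = ve ∨ a = 0 ∧ v 0 ∈ Ok 1) ∧ (b = vf d ∨ b = 0 ∧ v 1 ∈ Ok (d + 1)) ∧
    (c = vg d ∨ c = 0 ∧ v 2 ∈ Ok (d + 1)) ∧ v + (a + b + c) ∈ act tau (od d) := by
  rw [tau_od]
  obtain ⟨a, ha, a0, a1, a2⟩ : ∃ a : V3, (a = ve ∨ a = 0 ∧ v 0 ∈ Ok 1) ∧ v 0 + a 0 ∈ Ok 1 ∧ a 1 = 0 ∧ a 2 = 0 := by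
    rcases Ok_succ hv.1 with h | h
    · exact ⟨0, Or.inr ⟨rfl, h⟩, by simpa using h, rfl, rfl⟩
    · exact ⟨ve, Or.inl rfl, by rw [T_zero] at h; exact h, rfl, rfl⟩
  obtain ⟨b, hb, b0, b1, b2⟩ : ∃ a : V3, (a = vf d ∨ a = 0 ∧ v 1 ∈ Ok (d + 1)) ∧ v 1 + a 1 ∈ Ok (d + 1) ∧ a 0 = 0 ∧ a 2 = 0 := by
    rcases Ok_succ hv.2.1 with h | h
    · exact ⟨0, Or.inr ⟨rfl, h⟩, by simpa using h, rfl, rfl⟩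
    · exact ⟨vf d, Or.inl rfl, h, rfl, rfl⟩
  obtain ⟨c, hc, c0, c1, c2⟩ : ∃ a : V3, (a = vg d ∨ a = 0 ∧ v 2 ∈ Ok (d + 1)) ∧ v 2 + a 2 ∈ Ok (d + 1) ∧ a 0 = 0 ∧ a 1 = 0 := by
    rcases Ok_succ hv.2.2 with h | h
    · exact ⟨0, Or.inr ⟨rfl, h⟩, by simpa using h, rfl, rfl⟩
    · exact ⟨vg d, Or.inl rfl, h, rfl, rfl⟩
  refine ⟨a, b, c, ha, hb, hc, ?_, ?_, ?_⟩
  · change v 0 + (a 0 + b 0 + c 0) ∈ _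
    rw [b1, c1, add_zero, add_zero]; exact a0
  · change v 1 + (a 1 + b 1 + c 1) ∈ _
    rw [a1, c2, add_zero, zero_add]; exact b0
  · change v 2 + (a 2 + b 2 + c 2) ∈ _
    rw [a2, b2, zero_add, zero_add]; exact c0

lemma resid' {d : ℕ} {v : V3} (hv : v ∈ od d) : ∃ a b c : V3,
    (a = 0 ∨ a = ve ∧ v 0 ∉ Ok 1) ∧ (b = 0 ∨ b = vf d ∧ v 1 ∉ Ok (d + 1)) ∧
    (c = 0 ∨ c = vg d ∧ v 2 ∉ Ok (d + 1)) ∧ v + (a + b + c) ∈ act tau (od d) := by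
  rw [tau_od]
  obtain ⟨a, ha, a0, a1, a2⟩ : ∃ a : V3, (a = 0 ∨ a = ve ∧ v 0 ∉ Ok 1) ∧ v 0 + a 0 ∈ Ok 1 ∧ a 1 = 0 ∧ a 2 = 0 := by
    by_cases h0 : v 0 ∈ Ok 1
    · exact ⟨0, Or.inl rfl, by simpa using h0, rfl, rfl⟩
    · have h := (Ok_succ hv.1).resolve_left h0
      exact ⟨ve, Or.inr ⟨rfl, h0⟩, by rw [T_zero] at h; exact h, rfl, rfl⟩
  obtain ⟨b, hb, b0, b1, b2⟩ : ∃ a : V3, (a = 0 ∨ a = vf d ∧ v 1 ∉ Ok (d + 1)) ∧ v 1 + a 1 ∈ Ok (d + 1) ∧ a 0 = 0 ∧ a 2 = 0 := by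
    by_cases h0 : v 1 ∈ Ok (d + 1)
    · exact ⟨0, Or.inl rfl, by simpa using h0, rfl, rfl⟩
    · have h := (Ok_succ hv.2.1).resolve_left h0
      exact ⟨vf d, Or.inr ⟨rfl, h0⟩, h, rfl, rfl⟩
  obtain ⟨c, hc, c0, c1, c2⟩ : ∃ a : V3, (a = 0 ∨ a = vg d ∧ v 2 ∉ Ok (d + 1)) ∧ v 2 + a 2 ∈ Ok (d + 1) ∧ a 0 = 0 ∧ a 1 = 0 := by
    by_cases h0 : v 2 ∈ Ok (d + 1)
    · exact ⟨0, Or.inl rfl, by simpa using h0, rfl, rfl⟩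
    · have h := (Ok_succ hv.2.2).resolve_left h0
      exact ⟨vg d, Or.inr ⟨rfl, h0⟩, h, rfl, rfl⟩
  refine ⟨a, b, c, ha, hb, hc, ?_, ?_, ?_⟩
  · change v 0 + (a 0 + b 0 + c 0) ∈ _
    rw [b1, c1, add_zero, add_zero]; exact a0
  · change v 1 + (a 1 + b 1 + c 1) ∈ _
    rw [a1, c2, add_zero, zero_add]; exact b0
  · change v 2 + (a 2 + b 2 + c 2) ∈ _
    rw [a2, b2, zero_add, zero_add]; exact c0

lemma coordL {d : ℕ} (h1 : act tau (od d) ≤ L) (h2 : L ≤ od d)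
    (h : CoordP (ve ∈ L) (vf d ∈ L) (vg d ∈ L) (ve + vf d ∈ L) (ve + vg d ∈ L) (vf d + vg d ∈ L)
      (ve + vf d + vg d ∈ L)) :
    ∃ i j k : ℤ, (i = 0 ∨ i = 1) ∧ (j = 0 ∨ j = 1) ∧ (k = 0 ∨ k = 1) ∧ L = Lat i (d + j) (d + k) := by
  classical
  refine ⟨if ve ∈ L then 0 else 1, if vf d ∈ L then 0 else 1, if vg d ∈ L then 0 else 1,
    by split_ifs <;> simp, by split_ifs <;> simp, by split_ifs <;> simp, ?_⟩
  apply le_antisymm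
  · intro v hv
    have hv0 := h2 hv
    obtain ⟨a, b, c, ha, hb, hc, hr⟩ := resid hv0
    have hr := (mem_cong h1 hr).mp hv
    obtain ⟨p1, p2, p3, p4⟩ := h
    have key : (ve ∈ L ∨ v 0 ∈ Ok 1) ∧ (vf d ∈ L ∨ v 1 ∈ Ok (d + 1)) ∧
        (vg d ∈ L ∨ v 2 ∈ Ok (d + 1)) := by
      rcases ha with rfl | ⟨rfl, ha⟩
      · rcases hb with rfl | ⟨rfl, hb⟩
        · rcases hc with rfl | ⟨rfl, hc⟩
          · have := p4 hr
            exact ⟨Or.inl this.1, Or.inl this.2.1, Or.inl this.2.2⟩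
          · rw [add_zero] at hr
            have := p1 hr
            exact ⟨Or.inl this.1, Or.inl this.2, Or.inr hc⟩
        · rw [add_zero] at hr
          rcases hc with rfl | ⟨rfl, hc⟩
          · have := p2 hr
            exact ⟨Or.inl this.1, Or.inr hb, Or.inl this.2⟩
          · rw [add_zero] at hr
            exact ⟨Or.inl hr, Or.inr hb, Or.inr hc⟩
      · rw [zero_add] at hr
        rcases hb with rfl | ⟨rfl, hb⟩
        · rcases hc with rfl | ⟨rfl, hc⟩
          · have := p3 hr
            exact ⟨Or.inr ha, Or.inl this.1, Or.inl this.2⟩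
          · rw [add_zero] at hr
            exact ⟨Or.inr ha, Or.inl hr, Or.inr hc⟩
        · rw [zero_add] at hr
          rcases hc with rfl | ⟨rfl, hc⟩
          · exact ⟨Or.inr ha, Or.inr hb, Or.inl hr⟩
          · exact ⟨Or.inr ha, Or.inr hb, Or.inr hc⟩
    refine ⟨?_, ?_, ?_⟩
    · split_ifs with h
      · exact hv0.1
      · exact key.1.resolve_left h
    · split_ifs with h
      · rw [add_zero]; exact hv0.2.1
      · exact key.2.1.resolve_left h
    · split_ifs with h
      · rw [add_zero]; exact hv0.2.2
      · exact key.2.2.resolve_left h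
  · intro v hv
    have hv0 : v ∈ od d := ⟨Ok_anti (by split_ifs <;> omega) hv.1,
      Ok_anti (by split_ifs <;> omega) hv.2.1, Ok_anti (by split_ifs <;> omega) hv.2.2⟩
    obtain ⟨a, b, c, ha, hb, hc, hr⟩ := resid' hv0
    refine (mem_cong h1 hr).mpr (add_mem (add_mem ?_ ?_) ?_)
    · rcases ha with rfl | ⟨rfl, ha⟩
      · exact zero_mem _
      · have := hv.1
        split_ifs at this with h
        · exact h
        · exact absurd this ha
    · rcases hb with rfl | ⟨rfl, ha⟩
      · exact zero_mem _
      · have := hv.2.1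
        split_ifs at this with h
        · exact h
        · exact absurd this ha
    · rcases hc with rfl | ⟨rfl, ha⟩
      · exact zero_mem _
      · have := hv.2.2
        split_ifs at this with h
        · exact h
        · exact absurd this ha

def PE (D : Dat G) (d : ℕ) (L : LL) : Prop := ∃ A, D.Rel A L (D.c 1) (od d)

lemma Vx1 (d : ℕ) : D.Vx (D.c 1) (od d) := ⟨1, d, rfl, by rw [Prod.snd_one, act_one]⟩

lemma Vx_h {h : G × GL3} (hh : h ∈ D.GP) (hL : D.Vx (D.c 1) L) : D.Vx (D.c 1) (act h.2 L) := by
  have := Vx_smul h hL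
  rwa [D.smul_c, mul_one, D.c_one.mpr hh] at this

lemma PE_near {d : ℕ} (hL : D.Vx (D.c 1) L) : PE D d L := ⟨D.c 1, Or.inl ⟨rfl, hL, Vx1 d⟩⟩

lemma Vx_Z (hL : D.Vx (D.c 1) L) : D.Vx (D.c 1) (act Zg L) := by
  have h := Vx_h (h := D.zw) D.z_mem hL
  have e : D.zw.2 = Zg := rfl
  rwa [e] at h
lemma Vx_Zi (hL : D.Vx (D.c 1) L) : D.Vx (D.c 1) (act Zg⁻¹ L) := by
  have h := Vx_h (h := D.zw⁻¹) (inv_mem D.z_mem) hL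
  have e : D.zw.2 = Zg := rfl
  rwa [Prod.snd_inv, e] at h

lemma PE_coord {d : ℕ} {i j k : ℤ} (hi : i = 0 ∨ i = 1) (hj : j = 0 ∨ j = 1) (hk : k = 0 ∨ k = 1) :
    PE D d (Lat i (d + j) (d + k)) := by
  have heq : ∀ {i j k i' j' k' : ℤ}, i = i' → j = j' → k = k' → Lat i j k = Lat i' j' k' := by
    rintro _ _ _ _ _ _ rfl rfl rfl; rfl
  rcases hi with rfl | rfl <;> rcases hj with rfl | rfl <;> rcases hk with rfl | rfl
  · rw [add_zero]; exact PE_near (Vx1 d)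
  · have := Vx_tau (-1) (Vx_Z (Vx1 (D := D) (d + 1)))
    rw [Z_act (by omega), tau_pow_act] at this
    rw [heq _ _ _] at this
    · exact PE_near this
    all_goals omega
  · have := Vx_tau 1 (Vx_Zi (Vx1 (D := D) d))
    rw [Zi_act (by omega), tau_pow_act] at this
    rw [heq _ _ _] at this
    · exact PE_near this
    all_goals omega
  · have := (Vx1 (D := D) (d + 1))
    rw [od, heq _ _ _] at this
    · exact PE_near this
    all_goals omega
  · cases d with
    | zero =>
      refine ⟨D.c D.yw, ?_⟩
      have := Rel_symm (bas1 (D := D) 0)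
      rw [od_zero]
      exact this
    | succ d =>
      have := Vx_tau 1 (Vx1 (D := D) d)
      rw [tau_pow_act, heq _ _ _] at this
      · exact PE_near this
      all_goals omega
  · have := Vx_Z (Vx1 (D := D) d)
    rw [Z_act (by omega), heq _ _ _] at this
    · exact PE_near this
    all_goals omega
  · cases d with
    | zero =>
      refine ⟨D.c D.yw⁻¹, ?_⟩
      have := bas3 (D := D) 0
      rw [od_zero]
      exact this
    | succ d =>
      have := Vx_tau 2 (Vx_Zi (Vx1 (D := D) d))
      rw [Zi_act (by omega), tau_pow_act, heq _ _ _] at this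
      · exact PE_near this
      all_goals omega
  · have := Vx_tau 1 (Vx1 (D := D) d)
    rw [tau_pow_act, heq _ _ _] at this
    · exact PE_near this
    all_goals omega

lemma zs_GP (d : ℕ) : zs D.xw D.zw d ∈ D.GP := by
  induction d with
  | zero => exact D.x_mem
  | succ d ih => exact mul_mem (mul_mem (mul_mem (inv_mem D.z_mem) (inv_mem ih)) D.z_mem) ih

lemma X_n_act_inv (d : ℕ) : act (zs Xg Zg d)⁻¹ (od d) = od d := by
  conv_lhs => rw [← X_n_act d, act_inv_act]

lemma PE_step {d : ℕ} (h : PE D d (act (zs Xg Zg d)⁻¹ L)) : PE D d L := by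
  obtain ⟨A, h⟩ := h
  have := Rel_smul (zs D.xw D.zw d) h
  rw [D.xs_snd, act_act_inv, X_n_act, D.smul_c, mul_one, D.c_one.mpr (zs_GP d)] at this
  exact ⟨_, this⟩

lemma relE0 {d : ℕ} (h1 : act tau (od d) ≤ L) (h2 : L ≤ od d) : PE D d L := by
  have st : ∀ {L : LL}, act tau (od d) ≤ L → act tau (od d) ≤ act (zs Xg Zg d)⁻¹ L := by
    intro L h
    have := act_le (g := (zs Xg Zg d)⁻¹) h
    rwa [← act_tau1, X_n_act_inv] at this
  have st2 : ∀ {L : LL}, L ≤ od d → act (zs Xg Zg d)⁻¹ L ≤ od d := by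
    intro L h
    have := act_le (g := (zs Xg Zg d)⁻¹) h
    rwa [X_n_act_inv] at this
  have fin : ∀ {L : LL}, act tau (od d) ≤ L → L ≤ od d → CoordP (ve ∈ L) (vf d ∈ L) (vg d ∈ L)
      (ve + vf d ∈ L) (ve + vg d ∈ L) (vf d + vg d ∈ L) (ve + vf d + vg d ∈ L) → PE D d L := by
    intro L h1 h2 h
    obtain ⟨i, j, k, hi, hj, hk, rfl⟩ := coordL h1 h2 h
    exact PE_coord hi hj hk
  rcases combL (L := L) ve (vf d) (vg d) with h | h | h | h
  · exact fin h1 h2 h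
  · apply PE_step
    obtain ⟨p1, p2, p3, p4, p5, p6, p7⟩ := stepL h1
    refine fin (st h1) (st2 h2) ?_
    rw [p1, p2, p3, p4, p5, p6, p7]; exact h
  · apply PE_step
    apply PE_step
    obtain ⟨p1, p2, p3, p4, p5, p6, p7⟩ := stepL h1
    obtain ⟨q1, q2, q3, q4, q5, q6, q7⟩ := stepL (st h1)
    refine fin (st (st h1)) (st2 (st2 h2)) ?_
    rw [q1, q2, q3, q4, q5, q6, q7, p1, p2, p3, p4, p5, p6, p7]; exact h
  · apply PE_step
    apply PE_step
    apply PE_step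
    obtain ⟨p1, p2, p3, p4, p5, p6, p7⟩ := stepL h1
    obtain ⟨q1, q2, q3, q4, q5, q6, q7⟩ := stepL (st h1)
    obtain ⟨r1, r2, r3, r4, r5, r6, r7⟩ := stepL (st (st h1))
    refine fin (st (st (st h1))) (st2 (st2 (st2 h2))) ?_
    rw [r1, r2, r3, r4, r5, r6, r7, q1, q2, q3, q4, q5, q6, q7, p1, p2, p3, p4, p5, p6, p7]; exact h

lemma relE (hM : D.Vx B M) (h1 : act tau M ≤ L) (h2 : L ≤ M) : ∃ A, D.Rel A L B M := by
  obtain ⟨g, d, e1, e2⟩ := Vx_std hM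
  have h1 := act_le (g := g.2) h1
  rw [← act_tau1, e2] at h1
  have h2 := act_le (g := g.2) h2
  rw [e2] at h2
  obtain ⟨A, hA⟩ := relE0 (D := D) h1 h2
  have := Rel_smul g⁻¹ hA
  rw [Prod.snd_inv, act_inv_act, ← e1, ← e2, act_inv_act, inv_smul_smul] at this
  exact ⟨_, this⟩

end rel
end Bu

namespace Bu

section rel
variable {G : Type*} [Group G] {D : Dat G} {A B C : D.Q} {L M N : LL}

lemma relT_mid (h1 : act tau M ≤ L) (h2 : L ≤ N) (h3 : N ≤ M)
    (hA : D.Rel A L C N) (hB : D.Rel B M C N) : D.Rel A L B M := by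
  have hB' := Rel_tau 1 0 hB
  rw [zpow_one, zpow_zero, act_one] at hB'
  have h := relT (act_le h3) h1 h2 hB' hA
  have := Rel_tau (-1) 0 h
  rw [zpow_zero, act_one, _root_.zpow_neg, zpow_one, act_inv_act] at this
  exact Rel_symm this

lemma act_sup_le {g : GL3} {L M K : LL} (h1 : act g L ≤ K) (h2 : act g M ≤ K) : act g (L ⊔ M) ≤ K := by
  rw [← act_le_iff (g := g⁻¹), act_inv_act] at *
  exact sup_le h1 h2

def SS (n : ℕ) (L : LL) : Prop := act tau L ≤ L ∧ act (tau ^ (n : ℤ)) L0 ≤ L ∧ L ≤ L0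

def Dat.Sec (D : Dat G) (n : ℕ) (s : LL → D.Q) : Prop :=
  (∀ j : ℕ, j ≤ n → s (act (tau ^ (j : ℤ)) L0) = D.c 1) ∧
  ∀ L M, SS n L → SS n M → act tau M ≤ L → L ≤ M → D.Rel (s L) L (s M) M

lemma Vx10 : D.Vx (D.c 1) L0 := by
  have := Vx1 (D := D) 0
  rwa [od_zero] at this

lemma tL0 (n : ℕ) : act (tau ^ (n : ℤ)) L0 = Lat n n n := by
  rw [tau_pow_act]; simp only [zero_add]

lemma SS_pow {n j : ℕ} (h : j ≤ n) : SS n (act (tau ^ (j : ℤ)) L0) := by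
  rw [SS, tL0, tL0, tau_act, Lat_le, Lat_le, Lat_le]
  omega

lemma sec_exists (n : ℕ) : ∃ s, D.Sec n s := by
  induction n with
  | zero =>
    refine ⟨fun _ => D.c 1, fun _ _ => rfl, ?_⟩
    have key : ∀ L, SS 0 L → L = L0 := by
      intro L h
      have h2 := h.2.1
      rw [tL0] at h2
      exact le_antisymm h.2.2 h2
    intro L M hL hM _ _
    rw [key L hL, key M hM]
    exact Or.inl ⟨rfl, Vx10, Vx10⟩
  | succ n ih =>
    obtain ⟨s, hs1, hs2⟩ := ih
    obtain ⟨Tn, hTn⟩ : ∃ Tn, Tn = act (tau ^ (n : ℤ)) L0 := ⟨_, rfl⟩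
    have hT : act tau Tn = act (tau ^ ((n + 1 : ℕ) : ℤ)) L0 := by
      rw [hTn, tL0, tL0, tau_act]; push_cast; rfl
    have hST : SS n Tn := hTn ▸ SS_pow le_rfl
    have hup : ∀ L, SS (n + 1) L → SS n (L ⊔ Tn) := by
      intro L h
      exact ⟨act_sup_le (h.1.trans le_sup_left) (hST.1.trans le_sup_right), hTn ▸ le_sup_right,
        sup_le h.2.2 hST.2.2⟩
    have hE : ∀ L, ∃ A, SS (n + 1) L → D.Rel A L (s (L ⊔ Tn)) (L ⊔ Tn) := by
      intro L
      by_cases h : SS (n + 1) L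
      · have h0 := hup L h
        have hV := (Rel_Vx (hs2 _ _ h0 h0 h0.1 le_rfl)).1
        obtain ⟨A, hA⟩ := relE (L := L) hV (act_sup_le h.1 (hT.trans_le h.2.1)) le_sup_left
        exact ⟨A, fun _ => hA⟩
      · exact ⟨D.c 1, fun h' => absurd h' h⟩
    choose s' hs' using hE
    refine ⟨s', ?_, ?_⟩
    · intro j hj
      have hS := SS_pow hj
      have hR := hs' _ hS
      rcases Nat.lt_or_ge n j with hlt | hle
      · obtain rfl : j = n + 1 := by omega
        rw [← hT] at hR ⊢
        rw [sup_eq_right.mpr hST.1, hTn, hs1 n le_rfl] at hR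
        rw [← hTn] at hR
        have hR2 : D.Rel (D.c 1) (act tau Tn) (D.c 1) Tn := by
          have v := Vx_tau (n : ℤ) (Vx10 (D := D))
          have v2 := Vx_tau 1 v
          rw [zpow_one] at v2
          rw [← hTn] at v v2
          exact Or.inl ⟨rfl, v2, v⟩
        exact relU (relT le_rfl le_rfl hST.1 hR hR2)
      · have e : act (tau ^ (j : ℤ)) L0 ⊔ Tn = act (tau ^ (j : ℤ)) L0 := by
          rw [sup_eq_left, hTn, tL0, tL0, Lat_le]; omega
        rw [e, hs1 j hle] at hR
        exact relU hR
    · intro L M hL hM h1 h2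
      have hTL : act tau Tn ≤ L := hT.trans_le hL.2.1
      have e1 : act tau (M ⊔ Tn) ≤ L := act_sup_le h1 hTL
      have r1 := hs' L hL
      have r2 := hs' M hM
      have r3 := hs2 _ _ (hup L hL) (hup M hM) (e1.trans le_sup_left) (sup_le_sup_right h2 _)
      have r4 := relT_mid e1 le_sup_left (sup_le_sup_right h2 _) r1 (Rel_symm r3)
      exact relT e1 h2 le_sup_left r4 r2

lemma pos_word {γ : G × GL3} (h : γ ∈ Submonoid.closure {D.xw, D.yw}) :
    act γ.2 L0 ≤ L0 ∧ ∀ n s, D.Sec n s → act (tau ^ (n : ℤ)) L0 ≤ act γ.2 L0 → s (act γ.2 L0) = D.c γ := by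
  have hstab : ∀ g : GL3, act tau (act g L0) ≤ act g L0 := by
    intro g
    rw [act_tau1]
    apply act_le
    rw [tau_act, Lat_le]; omega
  induction h using Submonoid.closure_induction_right with
  | one =>
    rw [Prod.snd_one, act_one]
    refine ⟨le_rfl, fun n s hs _ => ?_⟩
    have := hs.1 0 (Nat.zero_le _)
    rwa [Nat.cast_zero, zpow_zero, act_one] at this
  | mul_right γ _ a ha ih =>
    obtain ⟨i1, i2⟩ := ih
    rcases ha with rfl | ha
    · have e : act (γ * D.xw).2 L0 = act γ.2 L0 := by
        change act (γ.2 * Xg) L0 = _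
        rw [act_mul, X_act_L0]
      rw [e, D.c_mul D.x_mem]
      exact ⟨i1, i2⟩
    · obtain rfl : a = D.yw := ha
      have e : (γ * D.yw).2 = γ.2 * Yg := rfl
      have hY : act Yg L0 ≤ L0 := by rw [Y_act, Lat_le]; omega
      have hY' : act tau L0 ≤ act Yg L0 := by rw [Y_act, tau_act, Lat_le]; omega
      have l1 : act (γ.2 * Yg) L0 ≤ act γ.2 L0 := by rw [act_mul]; exact act_le hY
      have l2 : act tau (act γ.2 L0) ≤ act (γ.2 * Yg) L0 := by
        rw [act_mul, act_tau1]; exact act_le hY'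
      rw [e]
      refine ⟨l1.trans i1, fun n s hs hn => ?_⟩
      have hs0 := i2 n s hs (hn.trans l1)
      have r := hs.2 (act (γ.2 * Yg) L0) (act γ.2 L0) ⟨hstab _, hn, l1.trans i1⟩
        ⟨hstab _, hn.trans l1, i1⟩ l2 l1
      rw [hs0] at r
      have r' : D.Rel (D.c (γ * D.yw)) (act (γ.2 * Yg) L0) (D.c γ) (act γ.2 L0) := by
        refine Or.inr (Or.inr ⟨γ, 0, rfl, rfl, rfl, ?_⟩)
        rw [zpow_zero, one_mul]
      exact relU (relT l2 le_rfl l1 r r')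

lemma gen4 {H : Type*} [Group H] {a : H} {k : ℕ} (h4 : a ^ 4 = 1) (h2 : a ^ 2 ≠ 1) (h : a ^ k = 1) : 4 ∣ k := by
  have : orderOf a = 2 ^ (1 + 1) := orderOf_eq_prime_pow (p := 2) (n := 1) h2 h4
  have := orderOf_dvd_of_pow_eq_one h
  rwa [‹orderOf a = _›] at this

lemma Xpow_one {k : ℕ} (h : Xg ^ k = 1) : 4 ∣ k := by
  have h4 : Xg ^ 4 = 1 := (HH_XZ 0).1
  have h2 : Xg ^ 2 = UU 0 1 := by
    rw [pow_two, Xg, UU_mul, map_one, one_mul, CharTwo.add_self_eq_zero, zero_add]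
  have h2' : Xg ^ 2 ≠ 1 := by
    rw [h2, ← UU_zero]
    intro h
    have := (UU_inj h).2
    exact one_ne_zero this
  exact gen4 h4 h2' h

lemma pos_scalar {γ : G × GL3} (h : γ ∈ Submonoid.closure {D.xw, D.yw}) {m : ℤ} (hm : γ.2 = tau ^ m) :
    γ.1 = 1 := by
  obtain ⟨h1, h2⟩ := pos_word h
  have m0 : 0 ≤ m := by
    rw [hm, tau_pow_act, Lat_le] at h1; omega
  lift m to ℕ using m0
  obtain ⟨s, hs⟩ := sec_exists (D := D) m
  have e := h2 m s hs (by rw [hm])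
  rw [hm, hs.1 m le_rfl] at e
  have hG := D.c_one.mp e.symm
  have hg : tw ^ (-(m : ℤ)) * γ ∈ D.GP := D.GP.mul_mem (D.GP.zpow_mem D.t_mem _) hG
  have hg2 : (tw ^ (-(m : ℤ)) * γ).2 = 1 := by
    rw [tw_snd, hm, ← _root_.zpow_add, neg_add_cancel, zpow_zero]
  have hI := Int3_of_eq (g := 1) (act_one L0)
  obtain ⟨k, hk⟩ := D.N' hg (by rw [hg2]; exact hI.1) (by rw [Prod.snd_inv, hg2]; exact hI.2)
  have hk2 : Xg ^ k = 1 := by rw [← xw_pow_snd (D := D), ← hk, hg2]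
  obtain ⟨j, rfl⟩ := Xpow_one hk2
  rw [pow_mul, D.x4, one_pow] at hk
  have := congrArg Prod.fst hk
  rw [Prod.fst_mul, Prod.fst_one] at this
  have e1 : (tw ^ (-(m : ℤ)) : G × GL3).1 = 1 := by
    rw [Prod.pow_fst]
    exact one_zpow _
  rwa [e1, one_mul] at this

lemma word_form {g : G × GL3} (h : g ∈ Subgroup.closure {D.xw, D.yw}) :
    ∃ a : ℤ, ∃ γ ∈ Submonoid.closure {D.xw, D.yw}, g = tw ^ a * γ := by
  have hx : D.xw ∈ Submonoid.closure {D.xw, D.yw} := Submonoid.subset_closure (Or.inl rfl)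
  have hy : D.yw ∈ Submonoid.closure {D.xw, D.yw} := Submonoid.subset_closure (Or.inr rfl)
  have hxi : D.xw⁻¹ = D.xw ^ 3 := by
    rw [inv_eq_iff_mul_eq_one, ← pow_succ', D.x4]
  have hyi : D.yw⁻¹ = tw⁻¹ * (D.yw * D.yw) := by
    rw [← D.y3]; group
  induction h using Subgroup.closure_induction_right with
  | one => exact ⟨0, 1, Submonoid.one_mem _, by rw [zpow_zero, one_mul]⟩
  | mul_right g _ a ha ih =>
    obtain ⟨k, γ, hγ, rfl⟩ := ih
    refine ⟨k, γ * a, Submonoid.mul_mem _ hγ ?_, mul_assoc _ _ _⟩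
    exact Submonoid.subset_closure ha
  | mul_inv_cancel g _ a ha ih =>
    obtain ⟨k, γ, hγ, rfl⟩ := ih
    rcases ha with rfl | ha
    · refine ⟨k, γ * D.xw ^ 3, Submonoid.mul_mem _ hγ (Submonoid.pow_mem _ hx _), ?_⟩
      rw [hxi, mul_assoc]
    · obtain rfl : a = D.yw := ha
      refine ⟨k - 1, γ * (D.yw * D.yw), Submonoid.mul_mem _ hγ (Submonoid.mul_mem _ hy hy), ?_⟩
      have hc : γ * tw⁻¹ = tw⁻¹ * γ := ((tw_comm γ).inv_left).eq.symm
      rw [hyi, _root_.zpow_sub_one, mul_assoc, ← mul_assoc γ, hc]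
      simp only [mul_assoc]

lemma word_scalar {g : G × GL3} (h : g ∈ Subgroup.closure {D.xw, D.yw}) {m : ℤ} (hm : g.2 = tau ^ m) :
    g.1 = 1 := by
  obtain ⟨a, γ, hγ, rfl⟩ := word_form h
  rw [tw_snd] at hm
  have hm' : γ.2 = tau ^ (-a + m) := by
    rw [_root_.zpow_add, ← hm, ← mul_assoc, ← _root_.zpow_add, neg_add_cancel, zpow_zero, one_mul]
  rw [Prod.fst_mul, pos_scalar hγ hm', mul_one, Prod.pow_fst]
  exact one_zpow _

end rel
end Bu

namespace Bu

lemma zs_sconj {H : Type*} [Group H] {x z s : H} (hs : Commute s z) (n : ℕ)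
    (h : s * zs x z n * s⁻¹ = zs x z (n + 1)) (k : ℕ) :
    s * zs x z (n + k) * s⁻¹ = zs x z (n + k + 1) := by
  induction k with
  | zero => exact h
  | succ k ih =>
    have e : ∀ a : H, s * br z a * s⁻¹ = br z (s * a * s⁻¹) := by
      intro a
      have h1 : z = s * z * s⁻¹ := by rw [hs.eq]; group
      have : br z (s * a * s⁻¹) = br (s * z * s⁻¹) (s * a * s⁻¹) := by rw [← h1]
      rw [this]; unfold br; group
    change s * br z (zs x z (n + k)) * s⁻¹ = br z (zs x z (n + k + 1))
    rw [e, ih]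

lemma HH_of {H : Type*} [Group H] {x z s : H} (n : ℕ) (hs : Commute s z)
    (h : s * zs x z n * s⁻¹ = zs x z (n + 1)) (h4 : ∀ j ≤ n, zs x z j ^ 4 = 1)
    (h2 : ∀ j ≤ n, Commute (zs x z j ^ 2) z) : HH x z := by
  have key : ∀ k, zs x z (n + k) ^ 4 = 1 ∧ Commute (zs x z (n + k) ^ 2) z := by
    intro k
    induction k with
    | zero => exact ⟨h4 n le_rfl, h2 n le_rfl⟩
    | succ k ih =>
      rw [← add_assoc, ← zs_sconj hs n h k, conj_pow, conj_pow, ih.1]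
      refine ⟨by group, ?_⟩
      exact ((hs.mul_left ih.2).mul_left hs.inv_left)
  intro j
  rcases le_total j n with hj | hj
  · exact ⟨h4 j hj, h2 j hj⟩
  · obtain ⟨k, rfl⟩ := Nat.exists_eq_add_of_le hj
    exact key k

lemma br_one {H : Type*} [Group H] {a b : H} (h : br a b = 1) : Commute a b := by
  unfold br at h
  have : a * b = b * a * (a⁻¹ * b⁻¹ * a * b) := by group
  rw [h, mul_one] at this
  exact this

lemma br_eq_one {H : Type*} [Group H] {a b : H} (h : Commute a b) : br a b = 1 := by
  unfold br
  rw [mul_assoc, h.eq]; group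

lemma br_map {H K : Type*} [Group H] [Group K] (f : H →* K) (a b : H) : f (br a b) = br (f a) (f b) := by
  simp only [br, map_mul, map_inv]

abbrev GI (i : ℕ) := PresentedGroup (GiRels i)
abbrev mki (i : ℕ) : FreeGroup (Fin 3) →* GI i := PresentedGroup.mk (GiRels i)

lemma xs_map {H : Type*} [Group H] (f : FreeGroup (Fin 3) →* H) (j : ℕ) :
    f (xseq gx gy j) = zs (f gx) (f gy * f gx * f gy) j := by
  rw [xseq_eq_zs, zs_map, map_mul, map_mul]

def DI (i : ℕ) : Dat (GI i) where
  x := mki i gx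
  y := mki i gy
  hy := by
    rw [← map_pow]
    exact PresentedGroup.one_of_mem (Or.inl (Or.inl (Or.inl rfl)))
  hH := by
    apply HH_of (s := mki i gT) i
    · have : mki i _ = 1 := PresentedGroup.one_of_mem (rels := GiRels i)
        (Or.inl (Or.inl (Or.inr (Or.inl rfl))))
      rw [br_map, map_mul, map_mul] at this
      exact br_one this
    · have : mki i _ = 1 := PresentedGroup.one_of_mem (rels := GiRels i)
        (Or.inl (Or.inl (Or.inr (Or.inr rfl))))
      rw [map_mul, map_mul, map_mul, map_inv, map_inv, br_map, mul_inv_eq_one, xs_map, map_mul, map_mul] at this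
      exact this
    · intro j hj
      have : mki i _ = 1 := PresentedGroup.one_of_mem (rels := GiRels i)
        (Or.inl (Or.inr ⟨j, hj, rfl⟩))
      rw [map_pow, xs_map] at this
      exact this
    · intro j hj
      have : mki i _ = 1 := PresentedGroup.one_of_mem (rels := GiRels i)
        (Or.inr ⟨j, hj, rfl⟩)
      rw [br_map, map_pow, xs_map, map_mul, map_mul] at this
      exact br_one this

abbrev F2 := FreeGroup (Fin 2)
def jj : F2 →* FreeGroup (Fin 3) := FreeGroup.lift ![gx, gy]
def f2 : F2 →* GL3 := FreeGroup.lift ![Xg, Yg]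
def f1 : F2 →* GL3 := FreeGroup.lift ![X, Y]

lemma hom_ext2 {H : Type*} [Group H] {f g : F2 →* H} (h0 : f (.of 0) = g (.of 0)) (h1 : f (.of 1) = g (.of 1)) :
    f = g := by
  apply FreeGroup.ext_hom
  intro a
  fin_cases a
  · exact h0
  · exact h1

lemma jj0 : jj (.of 0) = gx := FreeGroup.lift_apply_of
lemma jj1 : jj (.of 1) = gy := FreeGroup.lift_apply_of
lemma f20 : f2 (.of 0) = Xg := FreeGroup.lift_apply_of
lemma f21 : f2 (.of 1) = Yg := FreeGroup.lift_apply_of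
lemma f10 : f1 (.of 0) = X := FreeGroup.lift_apply_of
lemma f11 : f1 (.of 1) = Y := FreeGroup.lift_apply_of

/-- direction A, abstract form -/
lemma dirA {P : Type*} [Group P] (μ : GL3 →* P) (d : P) (i : ℕ) (hc : μ tau ∈ Subgroup.center P)
    (hz : Commute d (μ Zg)) (hx : d * μ (zs Xg Zg i) * d⁻¹ = μ (zs Xg Zg (i + 1)))
    {w : F2} (hw : mki i (jj w) = 1) : μ (f2 w) ∈ Subgroup.center P := by
  let Φ : FreeGroup (Fin 3) →* P := FreeGroup.lift ![μ Xg, μ Yg, d]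
  have p0 : Φ gx = μ Xg := FreeGroup.lift_apply_of
  have p1 : Φ gy = μ Yg := FreeGroup.lift_apply_of
  have p2 : Φ gT = d := FreeGroup.lift_apply_of
  have pz : Φ gy * Φ gx * Φ gy = μ Zg := by
    rw [p0, p1, ← map_mul, ← map_mul, YXY]
  have px : ∀ j, Φ (xseq gx gy j) = μ (zs Xg Zg j) := by
    intro j
    rw [xs_map, pz, p0, zs_map]
  have e : Φ (jj w) = μ (f2 w) := by
    have : Φ.comp jj = μ.comp f2 := by
      apply hom_ext2
      · rw [MonoidHom.comp_apply, MonoidHom.comp_apply, jj0, f20, p0]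
      · rw [MonoidHom.comp_apply, MonoidHom.comp_apply, jj1, f21, p1]
    exact DFunLike.congr_fun this w
  rw [← e]
  have hn : Subgroup.normalClosure (GiRels i) ≤ (Subgroup.center P).comap Φ := by
    apply Subgroup.normalClosure_le_normal
    rintro r (((rfl | rfl | rfl) | ⟨j, -, rfl⟩) | ⟨j, -, rfl⟩)
    · change Φ _ ∈ Subgroup.center P
      have : Φ (gy ^ 3) = μ tau := by
        rw [map_pow, p1, ← map_pow, ← Y3, pow_succ, pow_two]
      rw [this]; exact hc
    · change Φ _ ∈ Subgroup.center P
      rw [br_map, map_mul, map_mul, pz, p2, br_eq_one hz]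
      exact Subgroup.one_mem _
    · change Φ _ ∈ Subgroup.center P
      rw [map_mul, map_mul, map_mul, map_inv, map_inv, br_map, map_mul, map_mul, pz, px, p2, hx, ← br_map]
      change μ (zs Xg Zg (i + 1)) * (μ (zs Xg Zg (i + 1)))⁻¹ ∈ _
      rw [mul_inv_cancel]
      exact Subgroup.one_mem _
    · change Φ _ ∈ Subgroup.center P
      rw [map_pow, px, ← map_pow, (HH_XZ j).1, map_one]
      exact Subgroup.one_mem _
    · change Φ _ ∈ Subgroup.center P
      rw [br_map, map_pow, px, map_mul, map_mul, pz, ← map_pow, ← br_map, br_eq_one (HH_XZ j).2, map_one]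
      exact Subgroup.one_mem _
  exact hn (PresentedGroup.mk_eq_one_iff.mp hw)

end Bu

namespace Bu

lemma unit_T {c c' : R2} (h : c * c' = 1) : ∃ n : ℤ, c = T n := by
  obtain ⟨n, p, hp⟩ := exists_T_pow c
  obtain ⟨m, p', hp'⟩ := exists_T_pow c'
  have e : p * p' = Polynomial.X ^ (n + m) := by
    apply Polynomial.toLaurent_injective
    rw [map_mul, hp, hp', map_pow, Polynomial.toLaurent_X, T_pow, mul_mul_mul_comm, h, one_mul, ← T_add]
    congr 1; push_cast; ring
  obtain ⟨j, -, u, hu⟩ := (dvd_prime_pow Polynomial.prime_X _).mp (Dvd.intro _ e)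
  have hu1 : (u : Polynomial (ZMod 2)) = 1 := by
    obtain ⟨r, hr, hr'⟩ := Polynomial.isUnit_iff.mp u.isUnit
    have : r = 1 := by
      have h0 := hr.ne_zero
      revert h0; clear hr hr'; revert r; decide
    rw [← hr', this, map_one]
  rw [hu1, mul_one] at hu
  refine ⟨j - n, ?_⟩
  rw [hu, map_pow, Polynomial.toLaurent_X, T_pow] at hp
  have : c = c * T n * T (-n) := by rw [mul_assoc, ← T_add, add_neg_cancel, T_zero, mul_one]
  rw [this, ← hp, ← T_add]; congr 1; ring

lemma scalar_K {S : Type*} [CommRing S] (c : S) :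
    Matrix.scalar (Fin 3) c = !![c, 0, 0; 0, c, 0; 0, 0, c] := by
  ext i j; fin_cases i <;> fin_cases j <;> simp

lemma center_tau {g : GL3} (hg : g ∈ Subgroup.center GL3) : ∃ n : ℤ, g = tau ^ n := by
  rw [Matrix.GeneralLinearGroup.center_eq_range_scalar] at hg
  obtain ⟨u, rfl⟩ := hg
  obtain ⟨n, hn⟩ := unit_T u.mul_inv
  refine ⟨n, Units.ext ?_⟩
  rw [tau_pow, ← hn]
  rfl

/-- direction C -/
lemma dirC (i : ℕ) {w : F2} (hw : f2 w ∈ Subgroup.center GL3) : mki i (jj w) = 1 := by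
  obtain ⟨n, hn⟩ := center_tau hw
  let Ψ : F2 →* GI i × GL3 := ((mki i).comp jj).prod f2
  have h1 : ∀ v, Ψ v ∈ Subgroup.closure {(DI i).xw, (DI i).yw} := by
    intro v
    induction v using FreeGroup.induction_on with
    | C1 => rw [map_one]; exact Subgroup.one_mem _
    | of a =>
      fin_cases a
      · have : Ψ (FreeGroup.of 0) = (DI i).xw := by
          refine Prod.ext ?_ f20
          exact congrArg (mki i) jj0
        exact this ▸ Subgroup.subset_closure (Or.inl rfl)
      · have : Ψ (FreeGroup.of 1) = (DI i).yw := by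
          refine Prod.ext ?_ f21
          exact congrArg (mki i) jj1
        exact this ▸ Subgroup.subset_closure (Or.inr rfl)
    | inv_of a h => rw [map_inv]; exact Subgroup.inv_mem _ h
    | mul a b ha hb => rw [map_mul]; exact Subgroup.mul_mem _ ha hb
  exact word_scalar (h1 w) hn

def Bm : M3 := !![1, 0, 1; 0, 1, 0; 1, 1, 0]
def Bi : M3 := !![0, 1, 1; 0, 1, 0; 1, 1, 1]
lemma Bm_Bi : Bm * Bi = 1 := by
  simp only [Bm, Bi, Matrix.mul_fin_three, Matrix.one_fin_three]
  have h1 := two0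
  refine m3 ?_ ?_ ?_ ?_ ?_ ?_ ?_ ?_ ?_ <;> grind
lemma Bi_Bm : Bi * Bm = 1 := by
  simp only [Bm, Bi, Matrix.mul_fin_three, Matrix.one_fin_three]
  have h1 := two0
  refine m3 ?_ ?_ ?_ ?_ ?_ ?_ ?_ ?_ ?_ <;> grind
def Bg : GL3 := ⟨Bm, Bi, Bm_Bi, Bi_Bm⟩

lemma X_B : X * Bg = tau * (Bg * Xg) := by
  apply Units.ext
  change Xmat * Bm = tau.val * (Bm * Umat 1 1)
  rw [tau_val]
  simp only [Xmat, Bm, Umat, Matrix.smul_mul, Matrix.mul_fin_three, map_one]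
  have h1 := two0
  simp only [Matrix.smul_of, Matrix.smul_cons, smul_eq_mul, Matrix.smul_empty]
  change !![_, _, _; _, _, _; _, _, _] = _
  refine m3 ?_ ?_ ?_ ?_ ?_ ?_ ?_ ?_ ?_ <;> unfold t <;> grind

lemma Y_B : Y * Bg = tau * (Bg * Yg) := by
  apply Units.ext
  change Ymat * Bm = tau.val * (Bm * Ym)
  rw [tau_val]
  simp only [Ymat, Bm, Ym, Matrix.smul_mul, Matrix.mul_fin_three]
  have h1 := two0
  simp only [Matrix.smul_of, Matrix.smul_cons, smul_eq_mul, Matrix.smul_empty]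
  change !![_, _, _; _, _, _; _, _, _] = _
  refine m3 ?_ ?_ ?_ ?_ ?_ ?_ ?_ ?_ ?_ <;> unfold t <;> grind

lemma pp_one {g : GL3} : pp g = 1 ↔ g ∈ Subgroup.center GL3 := QuotientGroup.eq_one_iff g

lemma tau_center : tau ∈ Subgroup.center GL3 := Subgroup.mem_center_iff.mpr fun g => (tau_comm g).eq.symm

lemma pp_f1 (w : F2) : pp (f1 w) = pp Bg * pp (f2 w) * (pp Bg)⁻¹ := by
  have : pp.comp f1 = ((MulAut.conj (pp Bg)).toMonoidHom.comp pp).comp f2 := by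
    have ht := pp_one.mpr tau_center
    apply hom_ext2
    · change pp (f1 _) = pp Bg * pp (f2 _) * (pp Bg)⁻¹
      rw [f10, f20, eq_mul_inv_iff_mul_eq, ← map_mul, ← map_mul, X_B, map_mul, ht, one_mul]
    · change pp (f1 _) = pp Bg * pp (f2 _) * (pp Bg)⁻¹
      rw [f11, f21, eq_mul_inv_iff_mul_eq, ← map_mul, ← map_mul, Y_B, map_mul, ht, one_mul]
  exact DFunLike.congr_fun this w

/-- direction B -/
lemma dirB (w : F2) : pp (f1 w) = 1 ↔ f2 w ∈ Subgroup.center GL3 := by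
  rw [pp_f1, conj_eq_one_iff, pp_one]

def Dmm : M3 := !![(1 + t) ^ 3, 0, 0; 0, t * (1 + t) ^ 2, t ^ 3; 0, 0, t * (1 + t)]

lemma Dmm_Z : Dmm * Zg.val = Zg.val * Dmm := by
  change Dmm * Zm = Zm * Dmm
  simp only [Dmm, Zm, Matrix.mul_fin_three]
  have h1 := two0
  refine m3 ?_ ?_ ?_ ?_ ?_ ?_ ?_ ?_ ?_ <;> grind

lemma tqq : t * q = 1 := tq

lemma Dmm_X (n : ℕ) : Dmm * (zs Xg Zg n).val = (zs Xg Zg (n + 1)).val * Dmm := by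
  rw [X_n, X_n, UU_val, UU_val]
  simp only [Dmm, Umat, Matrix.mul_fin_three, map_pow, map_add, map_one, invert_q]
  have h1 := two0
  have h2 := tqq
  have h3 : t * (1 + q) = 1 + t := by linear_combination h2
  have h4 : (1 + t) ^ 3 * bb n = (1 + q) ^ (n + 1) * t ^ 3 + bb (n + 1) * (t * (1 + t)) := by
    cases n with
    | zero =>
      simp only [bb, pow_zero, pow_one, zero_add]
      grind
    | succ n =>
      simp only [bb]
      rw [pow_succ (1 + q) (n + 1), pow_succ (1 + q) n, pow_succ (1 + t) n]
      generalize (1 + q) ^ n = a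
      generalize (1 + t) ^ n = b
      grind
  refine m3 ?_ ?_ ?_ ?_ ?_ ?_ ?_ ?_ ?_
  · ring
  · rw [pow_succ]; linear_combination ((1 + q) ^ n * (1 + t) ^ 2) * (- h3)
  · linear_combination h4
  · ring
  · ring
  · ring
  · ring
  · ring
  · ring

lemma Dmm_det : Dmm.det ≠ 0 := by
  have : Dmm.det = t ^ 2 * (1 + t) ^ 6 := by
    rw [Matrix.det_fin_three]
    change (1 + t) ^ 3 * (t * (1 + t) ^ 2) * (t * (1 + t)) - (1 + t) ^ 3 * t ^ 3 * 0 - 0 * 0 * (t * (1 + t))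
      + 0 * t ^ 3 * 0 + 0 * 0 * 0 - 0 * (t * (1 + t) ^ 2) * 0 = _
    ring
  rw [this]
  have hl := lead_mul (lead_pow (lead_T 1) 2) (lead_pow lead_t1 6)
  intro h
  apply hl.2
  change t ^ 2 * (1 + t) ^ 6 ∈ _
  rw [h]
  exact zero_mem _

/-- direction A -/
lemma dirA' (i : ℕ) {w : F2} (hw : mki i (jj w) = 1) : f2 w ∈ Subgroup.center GL3 := by
  let K := FractionRing R2
  let f : R2 →+* K := algebraMap R2 K
  have hf : Function.Injective f := IsFractionRing.injective R2 K
  let μ : GL3 →* GL (Fin 3) K := Matrix.GeneralLinearGroup.map f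
  have hμ : ∀ g, (μ g).val = f.mapMatrix g.val := fun g => rfl
  have hfm : Function.Injective (f.mapMatrix (m := Fin 3)) := by
    intro A B h
    refine Matrix.ext fun i j => ?_
    exact hf (congrFun (congrFun h i) j)
  have hdet : (f.mapMatrix Dmm).det ≠ 0 := by
    rw [← RingHom.map_det]
    intro h
    exact Dmm_det (hf (h.trans (map_zero f).symm))
  let d : GL (Fin 3) K := Matrix.GeneralLinearGroup.mkOfDetNeZero _ hdet
  have hd : d.val = f.mapMatrix Dmm := rfl
  have hz : Commute d (μ Zg) := by
    apply Units.ext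
    rw [Units.val_mul, Units.val_mul, hd, hμ, ← map_mul, ← map_mul, Dmm_Z]
  have hx : d * μ (zs Xg Zg i) * d⁻¹ = μ (zs Xg Zg (i + 1)) := by
    rw [mul_inv_eq_iff_eq_mul]
    apply Units.ext
    rw [Units.val_mul, Units.val_mul, hd, hμ, hμ, ← map_mul, ← map_mul, Dmm_X]
  have hc : μ tau ∈ Subgroup.center (GL (Fin 3) K) := by
    rw [Matrix.GeneralLinearGroup.mem_center_iff_val_mem_range_scalar]
    refine ⟨f t, ?_⟩
    rw [hμ, tau_val, scalar_K]
    refine Matrix.ext fun i j => ?_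
    rw [RingHom.mapMatrix_apply, Matrix.map_apply]
    fin_cases i <;> fin_cases j <;> first | rfl | exact (map_zero f).symm
  have := dirA μ d i hc hz hx hw
  rw [Subgroup.mem_center_iff] at this ⊢
  intro g
  apply Units.ext
  apply hfm
  have h := congrArg Units.val (this (μ g))
  rw [Units.val_mul, Units.val_mul, hμ, hμ, ← map_mul, ← map_mul] at h
  exact h

end Bu

/-- **Lemma 2.1.** For each `i ≥ 0` there is an injective homomorphism
`ε_i : Q_{4,2} → G_i` with `ε_i(p(X)) = x` and `ε_i(p(Y)) = y`. -/
theorem statement3 (i : ℕ) :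
    ∃ εi : Q42 →* PresentedGroup (GiRels i),
      Function.Injective εi ∧
        εi ⟨pp X, Subgroup.subset_closure (Set.mem_insert _ _)⟩ = PresentedGroup.of 0 ∧
        εi ⟨pp Y, Subgroup.subset_closure (Set.mem_insert_of_mem _ rfl)⟩ =
          PresentedGroup.of 1 := by
  have hker : ∀ w, pp (Bu.f1 w) = 1 ↔ Bu.mki i (Bu.jj w) = 1 := fun w =>
    (Bu.dirB w).trans ⟨Bu.dirC i, Bu.dirA' i⟩
  let θ : Bu.F2 →* Q42 := FreeGroup.lift ![⟨pp X, Subgroup.subset_closure (Set.mem_insert _ _)⟩,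
    ⟨pp Y, Subgroup.subset_closure (Set.mem_insert_of_mem _ rfl)⟩]
  have θ0 : θ (.of 0) = ⟨pp X, Subgroup.subset_closure (Set.mem_insert _ _)⟩ := FreeGroup.lift_apply_of
  have θ1 : θ (.of 1) = ⟨pp Y, Subgroup.subset_closure (Set.mem_insert_of_mem _ rfl)⟩ :=
    FreeGroup.lift_apply_of
  have hθ : Q42.subtype.comp θ = pp.comp Bu.f1 := by
    apply Bu.hom_ext2
    · rw [MonoidHom.comp_apply, MonoidHom.comp_apply, θ0, Bu.f10]; rfl
    · rw [MonoidHom.comp_apply, MonoidHom.comp_apply, θ1, Bu.f11]; rfl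
  have hθ' : ∀ w, θ w = 1 ↔ Bu.mki i (Bu.jj w) = 1 := by
    intro w
    rw [← hker]
    have h := DFunLike.congr_fun hθ w
    rw [MonoidHom.comp_apply, MonoidHom.comp_apply] at h
    rw [← h]
    exact (map_eq_one_iff _ Q42.subtype_injective).symm
  have hs : Function.Surjective θ := by
    have h : Q42 ≤ (Q42.subtype.comp θ).range := by
      rw [Subgroup.closure_le]
      rintro a (rfl | ha)
      · exact ⟨.of 0, by rw [MonoidHom.comp_apply, θ0]; rfl⟩
      · obtain rfl : a = pp Y := ha
        exact ⟨.of 1, by rw [MonoidHom.comp_apply, θ1]; rfl⟩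
    rintro ⟨a, ha⟩
    obtain ⟨w, hw⟩ := h ha
    exact ⟨w, Subtype.ext hw⟩
  let g : {g : Bu.F2 →* PresentedGroup (GiRels i) // θ.ker ≤ g.ker} :=
    ⟨(Bu.mki i).comp Bu.jj, fun w hw => (hθ' w).mp hw⟩
  have hcomp : ∀ w, θ.liftOfSurjective hs g (θ w) = Bu.mki i (Bu.jj w) := fun w =>
    θ.liftOfRightInverse_comp_apply _ (Function.rightInverse_surjInv hs) g w
  refine ⟨θ.liftOfSurjective hs g, ?_, ?_, ?_⟩
  · rw [injective_iff_map_eq_one]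
    intro a ha
    obtain ⟨w, rfl⟩ := hs a
    rw [hcomp] at ha
    exact (hθ' w).mpr ha
  · rw [← θ0, hcomp, Bu.jj0]; rfl
  · rw [← θ1, hcomp, Bu.jj1]; rfl
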